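/- arXiv:1305.4112 — 3 statements merged into one kernel-verified Lean document; each statement's English description precedes it below -/
import Mathlib

section
/- For every λ̄ ≥ 8π there exist α₀ ∈ (0,1) and M > 0, depending only on λ̄, such that for every α ∈ (0, α₀) and every λ ∈ (0, λ̄) there exists a solution u of P(λ, ω_α) satisfying |u(x,y) − (λα/(2π))(1 − α²x² − y²)| ≤ M α² for all (x,y) ∈ ω_α. -/
open MeasureTheory Real Set Filter

noncomputable section

/-- The Euclidean plane ℝ². -/
abbrev R2 : Type := EuclideanSpace ℝ (Fin 2)

/-- The Laplacian of `u : R2 → ℝ`: the sum of the second derivatives of `u`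
along the two coordinate axes. -/
def lap (u : R2 → ℝ) (p : R2) : ℝ :=
  ∑ i : Fin 2, iteratedDeriv 2 (fun t : ℝ => u (p + t • EuclideanSpace.single i (1 : ℝ))) 0

/-- `u` is a solution of the mean field problem `P(λ, Ω)`:
`u ∈ C²(Ω) ∩ C⁰(cl Ω)`, `u = 0` on `∂Ω` and `-Δu = λ eᵘ / ∫_Ω eᵘ` in `Ω`. -/
def IsSolP (Ω : Set R2) (lam : ℝ) (u : R2 → ℝ) : Prop :=
  ContDiffOn ℝ 2 u Ω ∧ ContinuousOn u (closure Ω) ∧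
    (∀ p ∈ frontier Ω, u p = 0) ∧
    ∀ p ∈ Ω, -lap u p = lam * Real.exp (u p) / ∫ q in Ω, Real.exp (u q)

/-- The open ellipse `ω_α = {α²x² + y² < 1}` with semi-axes `1/α` and `1`. -/
def ellipseO (α : ℝ) : Set R2 := {p | α ^ 2 * p 0 ^ 2 + p 1 ^ 2 < 1}

open MvPolynomial (pderiv)

/-- The function on the plane defined by a real polynomial in two variables. -/
def pev (P : MvPolynomial (Fin 2) ℝ) (x : R2) : ℝ := MvPolynomial.eval (fun i => x i) P

/-- The Laplacian of a polynomial in two variables. -/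
def polyLap : MvPolynomial (Fin 2) ℝ →ₗ[ℝ] MvPolynomial (Fin 2) ℝ :=
  ∑ i : Fin 2, (pderiv i).toLinearMap ∘ₗ (pderiv i).toLinearMap

lemma polyLap_apply (P : MvPolynomial (Fin 2) ℝ) :
    polyLap P = ∑ i : Fin 2, pderiv i (pderiv i P) := by
  simp [polyLap]

lemma pderiv_polyLap (i : Fin 2) (P : MvPolynomial (Fin 2) ℝ) :
    pderiv i (polyLap P) = polyLap (pderiv i P) := by
  have hc : ∀ (j : Fin 2) (Q : MvPolynomial (Fin 2) ℝ),
      pderiv i (pderiv j Q) = pderiv j (pderiv i Q) := by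
    intro j Q
    ext m
    simp only [MvPolynomial.coeff_pderiv]
    rcases eq_or_ne i j with rfl | hij
    · rfl
    · rw [add_right_comm]
      simp [hij, hij.symm]
      ring
  simp [polyLap_apply, hc]

lemma hasFDerivAt_pev (P : MvPolynomial (Fin 2) ℝ) (x : R2) :
    HasFDerivAt (pev P)
      (∑ i : Fin 2, pev (pderiv i P) x • (EuclideanSpace.proj i : R2 →L[ℝ] ℝ)) x := by
  induction P using MvPolynomial.induction_on with
  | C a =>
    have : pev (MvPolynomial.C a) = fun _ => a := by ext; simp [pev]
    rw [this]
    simpa [pev] using hasFDerivAt_const a x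
  | add p q hp hq =>
    have : pev (p + q) = fun y => pev p y + pev q y := by ext; simp [pev]
    rw [this]
    refine (hp.add hq).congr_fderiv ?_
    simp only [← Finset.sum_add_distrib, pev, map_add, add_smul]
  | mul_X p n hp =>
    have : pev (p * MvPolynomial.X n) = fun y => pev p y * y n := by ext; simp [pev]
    rw [this]
    have hn : HasFDerivAt (fun y : R2 => y n) (EuclideanSpace.proj n : R2 →L[ℝ] ℝ) x :=
      (EuclideanSpace.proj n : R2 →L[ℝ] ℝ).hasFDerivAt
    refine (hp.mul hn).congr_fderiv ?_
    ext y
    fin_cases n <;> simp [pev, MvPolynomial.pderiv_X, Pi.single_apply] <;> ring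

lemma contDiff_pev (P : MvPolynomial (Fin 2) ℝ) {n : WithTop ℕ∞} : ContDiff ℝ n (pev P) := by
  induction P using MvPolynomial.induction_on with
  | C a =>
    have : pev (MvPolynomial.C a) = fun _ => a := by ext; simp [pev]
    rw [this]
    exact contDiff_const
  | add p q hp hq =>
    have : pev (p + q) = fun y => pev p y + pev q y := by ext; simp [pev]
    rw [this]
    exact hp.add hq
  | mul_X p n hp =>
    have : pev (p * MvPolynomial.X n) = fun y => pev p y * y n := by ext; simp [pev]
    rw [this]
    exact hp.mul (EuclideanSpace.proj n : R2 →L[ℝ] ℝ).contDiff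

/-- Parametrization of the line through `x` in the direction of the `i`-th axis. -/
lemma hasDerivAt_line (i : Fin 2) (x : R2) (t : ℝ) :
    HasDerivAt (fun t : ℝ => x + t • EuclideanSpace.single i (1 : ℝ))
      (EuclideanSpace.single i (1 : ℝ)) t := by
  simpa using ((hasDerivAt_id t).smul_const (EuclideanSpace.single i (1 : ℝ))).const_add x

lemma HasFDerivAt.hasDerivAt_line {w : R2 → ℝ} {d : Fin 2 → ℝ} {i : Fin 2} {x : R2} {t : ℝ}
    (h : HasFDerivAt w (∑ k : Fin 2, d k • (EuclideanSpace.proj k : R2 →L[ℝ] ℝ))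
      (x + t • EuclideanSpace.single i (1 : ℝ))) :
    HasDerivAt (fun t : ℝ => w (x + t • EuclideanSpace.single i (1 : ℝ))) (d i) t := by
  have := h.comp_hasDerivAt t (_root_.hasDerivAt_line i x t)
  convert! this using 1
  fin_cases i <;> simp

lemma lap_eq_of_hasFDerivAt {w : R2 → ℝ} {d : Fin 2 → R2 → ℝ} {d2 : Fin 2 → Fin 2 → ℝ} {x : R2}
    (h1 : ∀ᶠ y in nhds x,
      HasFDerivAt w (∑ k : Fin 2, d k y • (EuclideanSpace.proj k : R2 →L[ℝ] ℝ)) y)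
    (h2 : ∀ i, HasFDerivAt (d i) (∑ k : Fin 2, d2 i k • (EuclideanSpace.proj k : R2 →L[ℝ] ℝ)) x) :
    lap w x = ∑ i, d2 i i := by
  unfold lap
  refine Finset.sum_congr rfl fun i _ => ?_
  rw [iteratedDeriv_succ, iteratedDeriv_one]
  have hc : Tendsto (fun t : ℝ => x + t • EuclideanSpace.single i (1 : ℝ)) (nhds 0) (nhds x) := by
    have := (hasDerivAt_line i x 0).continuousAt.tendsto
    simpa using this
  have he : deriv (fun t : ℝ => w (x + t • EuclideanSpace.single i (1 : ℝ))) =ᶠ[nhds 0]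
      fun t => d i (x + t • EuclideanSpace.single i (1 : ℝ)) := by
    filter_upwards [hc.eventually h1] with t ht
    exact (HasFDerivAt.hasDerivAt_line ht).deriv
  rw [he.deriv_eq]
  refine (HasFDerivAt.hasDerivAt_line (d := d2 i) ?_).deriv
  simpa using h2 i

lemma lap_pev (P : MvPolynomial (Fin 2) ℝ) (x : R2) : lap (pev P) x = pev (polyLap P) x := by
  rw [lap_eq_of_hasFDerivAt (d := fun i => pev (pderiv i P))
    (d2 := fun i k => pev (pderiv k (pderiv i P)) x)
    (Eventually.of_forall fun y => hasFDerivAt_pev P y) (fun i => hasFDerivAt_pev _ x)]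
  simp [polyLap_apply, pev]

lemma contDiff_line {w : R2 → ℝ} (hw : ContDiff ℝ 2 w) (x v : R2) :
    ContDiff ℝ 2 (fun t : ℝ => w (x + t • v)) :=
  hw.comp (contDiff_const.add (contDiff_id.smul contDiff_const))

lemma lap_add {v w : R2 → ℝ} (hv : ContDiff ℝ 2 v) (hw : ContDiff ℝ 2 w) (x : R2) :
    lap (fun y => v y + w y) x = lap v x + lap w x := by
  unfold lap
  rw [← Finset.sum_add_distrib]
  refine Finset.sum_congr rfl fun i _ => ?_
  exact iteratedDeriv_fun_add (contDiff_line hv _ _).contDiffAt (contDiff_line hw _ _).contDiffAt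

lemma lap_const_mul (a : ℝ) (w : R2 → ℝ) (x : R2) :
    lap (fun y => a * w y) x = a * lap w x := by
  unfold lap
  rw [Finset.mul_sum]
  refine Finset.sum_congr rfl fun i _ => ?_
  exact iteratedDeriv_const_mul_field a _

lemma lap_comp_const_add (c : R2) (w : R2 → ℝ) (x : R2) :
    lap (fun y => w (c + y)) x = lap w (c + x) := by
  simp [lap, add_assoc]

/-- Reflection in the `i`-th coordinate. -/
def reflectCoord (i : Fin 2) (x : R2) : R2 := x - (2 * x i) • EuclideanSpace.single i (1 : ℝ)

lemma reflectCoord_apply (i k : Fin 2) (x : R2) :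
    reflectCoord i x k = if k = i then -x k else x k := by
  by_cases h : k = i
  · subst h
    simp [reflectCoord]
    ring
  · simp [reflectCoord, h]

lemma contDiff_reflectCoord (i : Fin 2) : ContDiff ℝ 2 (reflectCoord i) := by
  have : ContDiff ℝ 2 (fun x : R2 => x i) := (EuclideanSpace.proj i : R2 →L[ℝ] ℝ).contDiff
  exact contDiff_id.sub ((contDiff_const.mul this).smul contDiff_const)

lemma lap_comp_reflectCoord (i : Fin 2) (w : R2 → ℝ) (x : R2) :
    lap (fun y => w (reflectCoord i y)) x = lap w (reflectCoord i x) := by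
  unfold lap
  refine Finset.sum_congr rfl fun k _ => ?_
  by_cases h : k = i
  · subst h
    have : (fun t : ℝ => w (reflectCoord k (x + t • EuclideanSpace.single k (1 : ℝ)))) =
        fun t => (fun s : ℝ => w (reflectCoord k x + s • EuclideanSpace.single k (1 : ℝ))) (-t) := by
      ext t
      congr 1
      ext j
      by_cases hj : j = k <;> simp [reflectCoord_apply, hj]
      ring
    rw [this, iteratedDeriv_comp_neg 2
      (fun s : ℝ => w (reflectCoord k x + s • EuclideanSpace.single k (1 : ℝ)))]
    simp
  · congr 1
    funext t
    refine congrArg w ?_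
    ext j
    by_cases hj : j = i
    · subst hj
      simp [reflectCoord_apply, Ne.symm h]
    · simp [reflectCoord_apply, hj]

/-- Weak maximum principle. -/
lemma nonpos_of_lap_nonneg {K U : Set R2} (hK : IsCompact K) (hU : IsOpen U) {w : R2 → ℝ}
    (hw : ContDiff ℝ 2 w) (hl : ∀ x ∈ U, 0 ≤ lap w x) (hb : ∀ x ∈ K \ U, w x ≤ 0)
    (hUK : U ⊆ K) : ∀ x ∈ K, w x ≤ 0 := by
  intro x hx
  obtain ⟨B, hB⟩ := hK.exists_bound_of_continuousOn (f := fun y : R2 => y 0 ^ 2)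
    (by fun_prop)
  have hBx : ∀ y ∈ K, y 0 ^ 2 ≤ B := fun y hy => (le_abs_self _).trans (hB y hy)
  let q : MvPolynomial (Fin 2) ℝ := MvPolynomial.X 0 * MvPolynomial.X 0 - MvPolynomial.C B
  have hq : ∀ y, pev q y = y 0 ^ 2 - B := fun y => by simp [q, pev, pow_two]
  have hlq : ∀ y, lap (pev q) y = 2 := fun y => by
    rw [lap_pev]
    simp [q, pev, polyLap_apply, MvPolynomial.pderiv_X]
    norm_num
  have key : ∀ ε > 0, w x ≤ ε * B := by
    intro ε hε
    let W : R2 → ℝ := fun y => w y + ε * pev q y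
    have hWc : ContDiff ℝ 2 W := hw.add (contDiff_const.mul (contDiff_pev q))
    have hWl : ∀ y ∈ U, 0 < lap W y := by
      intro y hy
      rw [lap_add hw (contDiff_const.mul (contDiff_pev q)), lap_const_mul, hlq]
      linarith [hl y hy]
    obtain ⟨z, hz, hmax⟩ := hK.exists_isMaxOn ⟨x, hx⟩ hWc.continuous.continuousOn
    have hzU : z ∉ U := by
      intro hzU
      have hpos := hWl z hzU
      unfold lap at hpos
      obtain ⟨i, -, hi⟩ := Finset.exists_lt_of_sum_lt
        (lt_of_eq_of_lt (Finset.sum_const_zero (ι := Fin 2)) hpos)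
      set f : ℝ → ℝ := fun t => W (z + t • EuclideanSpace.single i (1 : ℝ)) with hf
      have hfc : Continuous f := (contDiff_line hWc z _).continuous
      have hlm : IsLocalMax f 0 := by
        have hc : Tendsto (fun t : ℝ => z + t • EuclideanSpace.single i (1 : ℝ))
            (nhds 0) (nhds z) := by
          have := (hasDerivAt_line i z 0).continuousAt.tendsto
          simpa using this
        filter_upwards [hc.eventually (hU.mem_nhds hzU)] with t ht
        simpa [hf] using hmax (hUK ht)
      rw [iteratedDeriv_succ, iteratedDeriv_one] at hi
      have hmin := isLocalMin_of_deriv_deriv_pos hi hlm.deriv_eq_zero hfc.continuousAt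
      have hconst : f =ᶠ[nhds 0] fun _ => f 0 := by
        filter_upwards [hlm, hmin] with t h1 h2
        exact le_antisymm h1 h2
      have := hconst.deriv.deriv_eq
      simp at this
      exact absurd hi (by simp [this])
    have hWz : W z ≤ 0 := by
      have h1 := hb z ⟨hz, hzU⟩
      have h2 := hBx z hz
      have h3 : ε * pev q z ≤ 0 := by
        rw [hq]
        exact mul_nonpos_of_nonneg_of_nonpos hε.le (by linarith)
      simp only [W]
      linarith
    have h4 : W x ≤ W z := hmax hx
    simp only [W, hq] at h4 hWz
    nlinarith [sq_nonneg (x 0)]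
  by_contra hcon
  push Not at hcon
  have hB0 : 0 ≤ B := (sq_nonneg _).trans (hBx x hx)
  have := key (w x / (2 * (B + 1))) (by positivity)
  rw [div_mul_eq_mul_div, le_div_iff₀ (by positivity)] at this
  nlinarith

/-- The closed square with centre `c` and half side `d`. -/
def closedSquare (c : R2) (d : ℝ) : Set R2 := {x | ∀ k, |x k - c k| ≤ d}

lemma isCompact_coordBox (a b : Fin 2 → ℝ) :
    IsCompact {x : R2 | ∀ k, a k ≤ x k ∧ x k ≤ b k} := by
  have h := (isCompact_Icc (a := a) (b := b)).image
    (EuclideanSpace.equiv (Fin 2) ℝ).symm.continuous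
  convert h using 1
  ext x
  simp only [mem_ofPred_eq, mem_image, mem_Icc, Pi.le_def]
  constructor
  · intro hx
    exact ⟨fun i => x i, ⟨fun i => (hx i).1, fun i => (hx i).2⟩, by ext; simp⟩
  · rintro ⟨y, ⟨h1, h2⟩, rfl⟩ k
    exact ⟨h1 k, h2 k⟩

/-- One-sided interior gradient estimate, by comparison on a half square. -/
lemma deriv_line_le {u : R2 → ℝ} (hu : ContDiff ℝ 2 u) {c : R2} {d M N : ℝ} (hd : 0 < d)
    (hM : ∀ x ∈ closedSquare c d, |u x| ≤ M)
    (hN : ∀ x ∈ closedSquare c d, |lap u x| ≤ N) (i : Fin 2) :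
    deriv (fun t : ℝ => u (c + t • EuclideanSpace.single i (1 : ℝ))) 0 ≤ 2 * M / d + N * d / 2 := by
  obtain ⟨j, hij⟩ : ∃ j : Fin 2, j ≠ i := exists_ne i
  have hk : ∀ k : Fin 2, k = i ∨ k = j := by omega
  have hc : c ∈ closedSquare c d := fun k => by simpa using hd.le
  have hM0 : 0 ≤ M := (abs_nonneg _).trans (hM c hc)
  have hN0 : 0 ≤ N := (abs_nonneg _).trans (hN c hc)
  let K : Set R2 := {x | ∀ k, (if k = i then 0 else -d) ≤ x k ∧ x k ≤ d}
  let U : Set R2 := {x | ∀ k, (if k = i then 0 else -d) < x k ∧ x k < d}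
  have hK : IsCompact K := isCompact_coordBox _ _
  have hU : IsOpen U := by
    simp only [U, ofPred_forall]
    refine isOpen_iInter_of_finite fun k => ?_
    have hck : Continuous fun x : R2 => x k := by fun_prop
    exact (isOpen_lt continuous_const hck).inter (isOpen_lt hck continuous_const)
  have hUK : U ⊆ K := fun x hx k => ⟨(hx k).1.le, (hx k).2.le⟩
  have hKs : ∀ x ∈ K, c + x ∈ closedSquare c d ∧ c + reflectCoord i x ∈ closedSquare c d := by
    intro x hx
    refine ⟨fun k => ?_, fun k => ?_⟩ <;> have := hx k <;> by_cases h : k = i <;>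
      simp [h, abs_le, reflectCoord_apply] at this ⊢ <;> constructor <;> linarith
  let ψ : MvPolynomial (Fin 2) ℝ :=
    MvPolynomial.C (M / d ^ 2) * (MvPolynomial.X j * MvPolynomial.X j +
      MvPolynomial.X i * (MvPolynomial.C (2 * d) - MvPolynomial.X i)) +
    MvPolynomial.C (N / 2) * (MvPolynomial.X i * (MvPolynomial.C d - MvPolynomial.X i))
  have hψ : ∀ x, pev ψ x = M / d ^ 2 * (x j ^ 2 + x i * (2 * d - x i)) +
      N / 2 * (x i * (d - x i)) := fun x => by simp [ψ, pev, pow_two]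
  have hψl : ∀ x, lap (pev ψ) x = -N := by
    intro x
    have hsum : ∀ f : Fin 2 → ℝ, ∑ k, f k = f i + f j := by
      intro f
      fin_cases i <;> fin_cases j <;> simp_all [add_comm]
    rw [lap_pev]
    simp only [polyLap_apply, pev, map_sum, hsum]
    simp [ψ, MvPolynomial.pderiv_X, hij, hij.symm]
    ring
  let w : R2 → ℝ := fun x =>
    (1 / 2 * u (c + x) + (-1 / 2) * u (c + reflectCoord i x)) + (-1) * pev ψ x
  have hu1 : ContDiff ℝ 2 (fun x => u (c + x)) := hu.comp (contDiff_const.add contDiff_id)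
  have hu2 : ContDiff ℝ 2 (fun x => u (c + reflectCoord i x)) :=
    hu.comp (contDiff_const.add (contDiff_reflectCoord i))
  have c1 := (contDiff_const (c := (1 / 2 : ℝ))).mul hu1
  have c2 := (contDiff_const (c := (-1 / 2 : ℝ))).mul hu2
  have c3 := (contDiff_const (c := (-1 : ℝ))).mul (contDiff_pev ψ (n := 2))
  have hw : ContDiff ℝ 2 w := (c1.add c2).add c3
  have hwl : ∀ x ∈ U, 0 ≤ lap w x := by
    intro x hx
    have e : lap w x = 1 / 2 * lap u (c + x) + (-1 / 2) * lap u (c + reflectCoord i x)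
        + (-1) * (-N) := by
      rw [lap_add (c1.add c2) c3, lap_add c1 c2, lap_const_mul, lap_const_mul, lap_const_mul, hψl,
        lap_comp_const_add, lap_comp_reflectCoord i (fun y => u (c + y)), lap_comp_const_add]
    rw [e]
    have h1 := abs_le.1 (hN _ (hKs x (hUK hx)).1)
    have h2 := abs_le.1 (hN _ (hKs x (hUK hx)).2)
    linarith
  have hwb : ∀ x ∈ K \ U, w x ≤ 0 := by
    rintro x ⟨hxK, hxU⟩
    have h1 := abs_le.1 (hM _ (hKs x hxK).1)
    have h2 := abs_le.1 (hM _ (hKs x hxK).2)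
    have hi := hxK i
    have hj := hxK j
    simp only [if_true, hij, if_false] at hi hj
    have hn2 : 0 ≤ N / 2 * (x i * (d - x i)) := by
      have : 0 ≤ x i * (d - x i) := mul_nonneg hi.1 (by linarith)
      positivity
    have hpd : 0 ≤ x i * (2 * d - x i) := mul_nonneg hi.1 (by linarith)
    have hbig : d ^ 2 ≤ x j ^ 2 + x i * (2 * d - x i) → w x ≤ 0 := by
      intro h
      have : M ≤ M / d ^ 2 * (x j ^ 2 + x i * (2 * d - x i)) := by
        rw [div_mul_eq_mul_div, le_div_iff₀ (by positivity)]
        gcongr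
      simp only [w, hψ]
      linarith
    by_cases h0 : x i = 0
    · have hr : reflectCoord i x = x := by
        ext k
        rw [reflectCoord_apply]
        split_ifs with h
        · simp [h, h0]
        · rfl
      have : 0 ≤ M / d ^ 2 * (x j ^ 2 + x i * (2 * d - x i)) := by positivity
      simp only [w, hr, hψ]
      linarith
    · apply hbig
      by_cases h1 : x i = d
      · rw [h1]
        nlinarith [sq_nonneg (x j)]
      · have : x j ^ 2 = d ^ 2 := by
          by_contra hne
          apply hxU
          intro k
          rcases hk k with rfl | rfl
          · simpa using ⟨lt_of_le_of_ne hi.1 (Ne.symm h0), lt_of_le_of_ne hi.2 h1⟩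
          · simp only [hij, if_false]
            refine ⟨lt_of_le_of_ne hj.1 fun h => hne ?_, lt_of_le_of_ne hj.2 fun h => hne ?_⟩ 
            · rw [← h, neg_sq]
            · rw [h]
        linarith
  have hmain := nonpos_of_lap_nonneg hK hU hw hwl hwb hUK
  set f : ℝ → ℝ := fun t => u (c + t • EuclideanSpace.single i (1 : ℝ)) with hf
  have hfd : HasDerivAt f (deriv f 0) 0 :=
    (((contDiff_line hu c _).differentiable (by norm_num)) 0).hasDerivAt
  have hfn : HasDerivAt (fun t => f (-t)) (-deriv f 0) 0 := by
    have h0 : HasDerivAt f (deriv f 0) (-0) := by simpa using hfd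
    simpa [Function.comp_def] using! h0.comp (0 : ℝ) (hasDerivAt_neg (0 : ℝ))
  have hG : HasDerivAt (fun t => 1 / 2 * f t - 1 / 2 * f (-t)) (deriv f 0) 0 := by
    convert! (hfd.const_mul (1 / 2 : ℝ)).sub (hfn.const_mul (1 / 2 : ℝ)) using 1
    ring
  refine le_of_tendsto hG.tendsto_slope_zero_right ?_
  filter_upwards [Ioo_mem_nhdsGT hd] with t ht
  have hx : t • EuclideanSpace.single i (1 : ℝ) ∈ K := by
    intro k
    rcases hk k with rfl | rfl
    · simpa using ⟨ht.1.le, ht.2.le⟩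
    · simp [hij, hd.le]
  have h := hmain _ hx
  have hr : reflectCoord i (t • EuclideanSpace.single i (1 : ℝ)) =
      (-t) • EuclideanSpace.single i (1 : ℝ) := by
    ext k
    rw [reflectCoord_apply]
    split_ifs with hki <;> simp [hki]
  simp only [w, hr, hψ] at h
  simp [hij] at h
  have hb : 1 / 2 * f t - 1 / 2 * f (-t) ≤ (2 * M / d + N * d / 2) * t := by
    have e1 : M / d ^ 2 * (t * (2 * d - t)) ≤ 2 * M / d * t := by
      have : 2 * M / d * t - M / d ^ 2 * (t * (2 * d - t)) = M / d ^ 2 * t ^ 2 := by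
        field_simp
        ring
      have : 0 ≤ M / d ^ 2 * t ^ 2 := by positivity
      linarith
    have e2 : 0 ≤ N / 2 * t ^ 2 := by positivity
    simp only [hf, neg_smul]
    nlinarith
  simp only [zero_add, neg_zero, sub_self, sub_zero, smul_eq_mul]
  rw [inv_mul_le_iff₀ ht.1]
  linarith

/-- Interior gradient estimate for polynomials. -/
lemma abs_pev_pderiv_le {P : MvPolynomial (Fin 2) ℝ} {c : R2} {d M N : ℝ} (hd : 0 < d)
    (hM : ∀ x ∈ closedSquare c d, |pev P x| ≤ M)
    (hN : ∀ x ∈ closedSquare c d, |pev (polyLap P) x| ≤ N) (i : Fin 2) :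
    |pev (pderiv i P) c| ≤ 2 * M / d + N * d / 2 := by
  have hder : ∀ Q : MvPolynomial (Fin 2) ℝ,
      deriv (fun t : ℝ => pev Q (c + t • EuclideanSpace.single i (1 : ℝ))) 0 =
        pev (pderiv i Q) c := fun Q => by
    have h0 : HasFDerivAt (pev Q) (∑ k : Fin 2, pev (pderiv k Q) c •
        (EuclideanSpace.proj k : R2 →L[ℝ] ℝ)) (c + (0 : ℝ) • EuclideanSpace.single i (1 : ℝ)) := by
      simpa using hasFDerivAt_pev Q c
    exact (HasFDerivAt.hasDerivAt_line (d := fun k => pev (pderiv k Q) c) h0).deriv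
  have hneg : ∀ Q x, pev (-Q) x = -pev Q x := fun Q x => by simp [pev]
  have h1 := deriv_line_le (contDiff_pev P) hd hM (by simpa only [lap_pev] using hN) i
  have h2 := deriv_line_le (contDiff_pev (-P)) hd (by simpa only [hneg, abs_neg] using hM)
    (by simpa only [lap_pev, map_neg, hneg, abs_neg] using hN) i
  rw [hder] at h1 h2
  rw [map_neg, hneg] at h2
  exact abs_le.2 ⟨by linarith, h1⟩

/-- The closed ellipse with semi-axes `1/α` and `1`. -/
def ellipseC (α : ℝ) : Set R2 := {p | α ^ 2 * p 0 ^ 2 + p 1 ^ 2 ≤ 1}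

/-- The polynomial `1 - α²x² - y²`. -/
def ellipsePoly (α : ℝ) : MvPolynomial (Fin 2) ℝ :=
  1 - MvPolynomial.C (α ^ 2) * (MvPolynomial.X 0 * MvPolynomial.X 0) -
    MvPolynomial.X 1 * MvPolynomial.X 1

lemma pev_ellipsePoly (α : ℝ) (x : R2) :
    pev (ellipsePoly α) x = 1 - α ^ 2 * x 0 ^ 2 - x 1 ^ 2 := by
  simp [ellipsePoly, pev, pow_two]

lemma polyLap_ellipsePoly (α : ℝ) :
    polyLap (ellipsePoly α) = -MvPolynomial.C (2 * (1 + α ^ 2)) := by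
  apply MvPolynomial.funext
  intro x
  simp [polyLap_apply, ellipsePoly, MvPolynomial.pderiv_X]
  ring

lemma totalDegree_pderiv_le {n : ℕ} {P : MvPolynomial (Fin 2) ℝ} (h : P.totalDegree ≤ n + 1)
    (i : Fin 2) : (pderiv i P).totalDegree ≤ n := by
  refine Finset.sup_le fun m hm => ?_
  rw [MvPolynomial.mem_support_iff, MvPolynomial.coeff_pderiv] at hm
  have := (MvPolynomial.le_totalDegree
    (MvPolynomial.mem_support_iff.2 (left_ne_zero_of_mul hm))).trans h
  rw [Finsupp.sum_add_index' (by simp) (by simp), Finsupp.sum_single_index rfl] at this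
  omega

lemma totalDegree_ellipsePoly_le (α : ℝ) : (ellipsePoly α).totalDegree ≤ 2 := by
  have hX : ∀ i : Fin 2, (MvPolynomial.X i * MvPolynomial.X i :
      MvPolynomial (Fin 2) ℝ).totalDegree ≤ 2 := fun i =>
    (MvPolynomial.totalDegree_mul _ _).trans (by simp)
  refine (MvPolynomial.totalDegree_sub _ _).trans (max_le ?_ (hX 1))
  refine (MvPolynomial.totalDegree_sub _ _).trans (max_le (by simp) ?_)
  refine (MvPolynomial.totalDegree_mul _ _).trans ?_
  rw [MvPolynomial.totalDegree_C, zero_add]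
  exact hX 0

lemma isOpen_ellipseO (α : ℝ) : IsOpen (ellipseO α) :=
  isOpen_lt (by fun_prop) continuous_const

lemma ellipseO_subset_ellipseC (α : ℝ) : ellipseO α ⊆ ellipseC α := fun x hx =>
  le_of_lt (show α ^ 2 * x 0 ^ 2 + x 1 ^ 2 < 1 from hx)

lemma isClosed_ellipseC (α : ℝ) : IsClosed (ellipseC α) :=
  isClosed_le (by fun_prop) continuous_const

lemma isCompact_ellipseC {α : ℝ} (hα : 0 < α) : IsCompact (ellipseC α) := by
  refine (isCompact_coordBox (fun _ => -(1 / α + 1)) (fun _ => 1 / α + 1)).of_isClosed_subset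
    (isClosed_ellipseC α) ?_
  intro x hx k
  have hx' : α ^ 2 * x 0 ^ 2 + x 1 ^ 2 ≤ 1 := hx
  have h0 : |x 0| ≤ 1 / α := by
    rw [le_div_iff₀ hα]
    refine abs_le_of_sq_le_sq' ?_ zero_le_one |>.2
    rw [mul_pow, sq_abs]
    nlinarith [sq_nonneg (x 1)]
  have h1 : |x 1| ≤ 1 := by
    refine abs_le_of_sq_le_sq ?_ zero_le_one
    nlinarith [mul_nonneg (sq_nonneg α) (sq_nonneg (x 0))]
  have hp : 0 < 1 / α := by positivity
  rw [← abs_le]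
  fin_cases k
  · exact h0.trans (by linarith)
  · exact h1.trans (by linarith)

lemma pev_mul (P Q : MvPolynomial (Fin 2) ℝ) (x : R2) : pev (P * Q) x = pev P x * pev Q x := by
  simp [pev]

/-- A polynomial vanishing on the open ellipse is zero. -/
lemma eq_zero_of_pev_eq_zero {α : ℝ} (hα : 0 < α) {P : MvPolynomial (Fin 2) ℝ}
    (h : ∀ x ∈ ellipseO α, pev P x = 0) : P = 0 := by
  refine MvPolynomial.funext_set (fun _ : Fin 2 => Ioo (0 : ℝ) (1 / (2 * (α + 1))))
    (fun _ => Ioo_infinite (by positivity)) fun y hy => ?_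
  rw [map_zero]
  refine h (WithLp.toLp 2 y) ?_
  have h0 := hy 0 (mem_univ _)
  have h1 := hy 1 (mem_univ _)
  have e0 : y 0 * (2 * (α + 1)) < 1 := (lt_div_iff₀ (by positivity)).1 h0.2
  have e1 : y 1 * (2 * (α + 1)) < 1 := (lt_div_iff₀ (by positivity)).1 h1.2
  have f0 : α * y 0 < 1 / 2 := by nlinarith [h0.1]
  have f1 : y 1 < 1 / 2 := by nlinarith [h1.1]
  change α ^ 2 * y 0 ^ 2 + y 1 ^ 2 < 1
  have g0 : 0 < α * y 0 := mul_pos hα h0.1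
  nlinarith [h1.1]

/-- A priori bound for the Dirichlet problem on the ellipse. -/
lemma abs_pev_le_of_polyLap {α : ℝ} (hα : 0 < α) {P : MvPolynomial (Fin 2) ℝ} {B : ℝ}
    (hb : ∀ x ∈ ellipseC α \ ellipseO α, pev P x = 0)
    (hl : ∀ x ∈ ellipseC α, |pev (polyLap P) x| ≤ B) :
    ∀ x ∈ ellipseC α, |pev P x| ≤ 1 / 2 * B := by
  have one_side : ∀ Q : MvPolynomial (Fin 2) ℝ, (∀ x ∈ ellipseC α \ ellipseO α, pev Q x = 0) →
      (∀ x ∈ ellipseC α, |pev (polyLap Q) x| ≤ B) → ∀ x ∈ ellipseC α, pev Q x ≤ 1 / 2 * B := by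
    intro Q hQ hQl x hx
    have hB : 0 ≤ B := (abs_nonneg _).trans (hQl x hx)
    have hpev : ∀ y, pev (Q - MvPolynomial.C (B / 2) * ellipsePoly α) y =
        pev Q y - B / 2 * pev (ellipsePoly α) y := fun y => by simp [pev]
    have hmax := nonpos_of_lap_nonneg (isCompact_ellipseC hα) (isOpen_ellipseO α)
      (w := pev (Q - MvPolynomial.C (B / 2) * ellipsePoly α)) (contDiff_pev _)
      (fun y hy => ?_) (fun y hy => ?_) (ellipseO_subset_ellipseC α) x hx
    · rw [hpev, pev_ellipsePoly] at hmax
      have : B / 2 * (1 - α ^ 2 * x 0 ^ 2 - x 1 ^ 2) ≤ B / 2 * 1 := by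
        gcongr
        nlinarith [sq_nonneg (x 1), mul_nonneg (sq_nonneg α) (sq_nonneg (x 0))]
      linarith
    · have e : pev (polyLap (Q - MvPolynomial.C (B / 2) * ellipsePoly α)) y =
          pev (polyLap Q) y + B * (1 + α ^ 2) := by
        rw [← MvPolynomial.smul_eq_C_mul, map_sub, map_smul, polyLap_ellipsePoly]
        simp [pev]
        ring
      rw [lap_pev, e]
      have := abs_le.1 (hQl y (ellipseO_subset_ellipseC α hy))
      nlinarith [sq_nonneg α]
    · have : 0 ≤ pev (ellipsePoly α) y := by
        rw [pev_ellipsePoly]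
        have : α ^ 2 * y 0 ^ 2 + y 1 ^ 2 ≤ 1 := hy.1
        linarith
      rw [hpev, hQ y hy]
      nlinarith
  have hneg : ∀ Q x, pev (-Q) x = -pev Q x := fun Q x => by simp [pev]
  intro x hx
  have h1 := one_side P hb hl x hx
  have h2 := one_side (-P) (fun y hy => by rw [hneg, hb y hy, neg_zero])
    (by simpa only [map_neg, hneg, abs_neg] using hl) x hx
  rw [hneg] at h2
  exact abs_le.2 ⟨by linarith, h1⟩

/-- The Dirichlet problem on the ellipse is solvable within polynomials. -/
lemma exists_polyPoisson {α : ℝ} (hα : 0 < α) :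
    ∃ T : MvPolynomial (Fin 2) ℝ →ₗ[ℝ] MvPolynomial (Fin 2) ℝ,
      (∀ f, polyLap (T f) = -f) ∧ (∀ f, ∀ x ∈ ellipseC α \ ellipseO α, pev (T f) x = 0) ∧
      T (MvPolynomial.C (2 * (1 + α ^ 2))) = ellipsePoly α := by
  let L : MvPolynomial (Fin 2) ℝ →ₗ[ℝ] MvPolynomial (Fin 2) ℝ :=
    -(polyLap ∘ₗ LinearMap.mulLeft ℝ (ellipsePoly α))
  have hL : ∀ q, L q = -polyLap (ellipsePoly α * q) := fun q => by simp [L]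
  have hbd : ∀ q, ∀ x ∈ ellipseC α \ ellipseO α, pev (ellipsePoly α * q) x = 0 := by
    rintro q x ⟨h1, h2⟩
    have h1' : α ^ 2 * x 0 ^ 2 + x 1 ^ 2 ≤ 1 := h1
    have h2' : ¬ α ^ 2 * x 0 ^ 2 + x 1 ^ 2 < 1 := h2
    have : 1 - α ^ 2 * x 0 ^ 2 - x 1 ^ 2 = 0 := by linarith
    rw [pev_mul, pev_ellipsePoly, this, zero_mul]
  have hne : ellipsePoly α ≠ 0 := by
    intro h
    have := pev_ellipsePoly α 0
    rw [h] at this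
    simp [pev] at this
  have hinj : Function.Injective L := by
    rw [injective_iff_map_eq_zero]
    intro q hq
    rw [hL, neg_eq_zero] at hq
    have h0 : ellipsePoly α * q = 0 := by
      refine eq_zero_of_pev_eq_zero hα fun x hx => ?_
      have := abs_pev_le_of_polyLap hα (P := ellipsePoly α * q) (B := 0) (hbd q)
        (fun y _ => by rw [hq]; simp [pev]) x (ellipseO_subset_ellipseC α hx)
      simpa using this
    exact (mul_eq_zero.1 h0).resolve_left hne
  have hsurj : Function.Surjective L := by
    intro f
    let V := MvPolynomial.restrictTotalDegree (Fin 2) ℝ f.totalDegree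
    have hV : ∀ q ∈ V, L q ∈ V := by
      intro q hq
      rw [MvPolynomial.mem_restrictTotalDegree] at hq ⊢
      rw [hL, MvPolynomial.totalDegree_neg, polyLap_apply]
      refine MvPolynomial.totalDegree_finsetSum_le fun i _ => ?_
      refine totalDegree_pderiv_le (totalDegree_pderiv_le ?_ i) i
      have := totalDegree_ellipsePoly_le α
      exact (MvPolynomial.totalDegree_mul _ _).trans (by omega)
    have hVinj : Function.Injective (L.restrict hV) := fun a b hab =>
      Subtype.ext (hinj (congrArg Subtype.val hab))
    obtain ⟨q, hq⟩ := LinearMap.injective_iff_surjective.1 hVinj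
      ⟨f, (MvPolynomial.mem_restrictTotalDegree _ _ _).2 le_rfl⟩
    exact ⟨q, congrArg Subtype.val hq⟩
  let E := LinearEquiv.ofBijective L ⟨hinj, hsurj⟩
  have hE : ∀ f, L (E.symm f) = f := fun f => E.apply_symm_apply f
  refine ⟨LinearMap.mulLeft ℝ (ellipsePoly α) ∘ₗ E.symm.toLinearMap, fun f => ?_,
    fun f => hbd _, ?_⟩
  · have := hE f
    rw [hL] at this
    exact neg_eq_iff_eq_neg.1 this
  · have h1 : L 1 = MvPolynomial.C (2 * (1 + α ^ 2)) := by
      rw [hL, mul_one, polyLap_ellipsePoly, neg_neg]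
    have h2 : E.symm (MvPolynomial.C (2 * (1 + α ^ 2))) = 1 := by
      rw [← h1]
      exact E.symm_apply_apply 1
    change ellipsePoly α * E.symm _ = _
    rw [h2, mul_one]

/-- Restriction of polynomials to a subset of the plane. -/
def polyRestrict (Q : Set R2) : MvPolynomial (Fin 2) ℝ →ₐ[ℝ] C(Q, ℝ) :=
  MvPolynomial.aeval fun i => ⟨fun x : Q => (x : R2) i, by fun_prop⟩

lemma polyRestrict_apply (Q : Set R2) (P : MvPolynomial (Fin 2) ℝ) (x : Q) :
    polyRestrict Q P x = pev P x := by
  induction P using MvPolynomial.induction_on with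
  | C a => simp [polyRestrict, pev]
  | add p q hp hq => simp_all [pev]
  | mul_X p n hp => simp_all [pev, polyRestrict]

lemma denseRange_polyRestrict (Q : Set R2) [CompactSpace Q] : DenseRange (polyRestrict Q) := by
  have h := ContinuousMap.subalgebra_topologicalClosure_eq_top_of_separatesPoints
    (polyRestrict Q).range (fun x y hxy => ?_)
  · intro f
    have hf : f ∈ (polyRestrict Q).range.topologicalClosure := by rw [h]; trivial
    exact hf
  · obtain ⟨i, hi⟩ : ∃ i, (x : R2) i ≠ (y : R2) i := by
      by_contra hcon
      push Not at hcon
      exact hxy (Subtype.ext (PiLp.ext hcon))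
    refine ⟨_, ⟨polyRestrict Q (MvPolynomial.X i), ⟨_, rfl⟩, rfl⟩, ?_⟩
    simpa [polyRestrict_apply, pev] using hi

/-- The solution operator of the Dirichlet problem on the ellipse, on continuous data. -/
lemma exists_poisson {α : ℝ} (hα : 0 < α) [CompactSpace (ellipseC α)] :
    ∃ (T : MvPolynomial (Fin 2) ℝ → MvPolynomial (Fin 2) ℝ)
      (S : C(ellipseC α, ℝ) →L[ℝ] C(ellipseC α, ℝ)),
      (∀ f, polyLap (T f) = -f) ∧
      (∀ f, S (polyRestrict _ f) = polyRestrict _ (T f)) ∧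
      (∀ f, ‖S f‖ ≤ 1 / 2 * ‖f‖) ∧
      (∀ f, ∀ x : ellipseC α, (x : R2) ∉ ellipseO α → S f x = 0) ∧
      S (algebraMap ℝ _ (2 * (1 + α ^ 2))) = polyRestrict _ (ellipsePoly α) := by
  obtain ⟨T, hT1, hT2, hT3⟩ := exists_polyPoisson hα
  have hd : DenseRange (polyRestrict (ellipseC α)).toLinearMap := denseRange_polyRestrict _
  have hbound : ∀ f, ‖((polyRestrict (ellipseC α)).toLinearMap ∘ₗ T) f‖ ≤
      1 / 2 * ‖(polyRestrict (ellipseC α)).toLinearMap f‖ := by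
    intro f
    rw [ContinuousMap.norm_le _ (by positivity)]
    intro x
    have := abs_pev_le_of_polyLap hα (P := T f)
      (B := ‖polyRestrict (ellipseC α) f‖) (hT2 f) (fun y hy => ?_) x x.2
    · simpa [polyRestrict_apply] using this
    · have h := (polyRestrict (ellipseC α) f).norm_coe_le_norm ⟨y, hy⟩
      rw [hT1]
      simpa [polyRestrict_apply, pev] using h
  let S := ((polyRestrict (ellipseC α)).toLinearMap ∘ₗ T).extendOfNorm
    (polyRestrict (ellipseC α)).toLinearMap
  have hS : ∀ f, S (polyRestrict _ f) = polyRestrict _ (T f) := fun f =>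
    LinearMap.extendOfNorm_eq hd ⟨_, hbound⟩ f
  refine ⟨T, S, hT1, hS, LinearMap.norm_extendOfNorm_apply_le hd _ hbound, ?_, ?_⟩
  · intro f x hx
    refine hd.induction_on (p := fun f => S f x = 0) f ?_ fun P => ?_
    · exact isClosed_eq (by fun_prop) continuous_const
    · change S (polyRestrict _ P) x = 0
      rw [hS, polyRestrict_apply]
      exact hT2 P x ⟨x.2, hx⟩
  · have := hS (MvPolynomial.C (2 * (1 + α ^ 2)))
    rw [hT3] at this
    rw [← this]
    congr 1
    exact ((polyRestrict (ellipseC α)).commutes _).symm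

lemma isCompact_closedSquare (c : R2) (d : ℝ) : IsCompact (closedSquare c d) := by
  convert isCompact_coordBox (fun k => c k - d) (fun k => c k + d) using 1
  ext x
  refine forall_congr' fun k => ?_
  rw [abs_le]
  constructor <;> rintro ⟨h1, h2⟩ <;> constructor <;> linarith

lemma exists_closedSquare_subset {U : Set R2} (hU : IsOpen U) {c : R2} (hc : c ∈ U) :
    ∃ d > 0, closedSquare c d ⊆ U := by
  obtain ⟨ε, hε, h⟩ := Metric.isOpen_iff.1 hU c hc
  refine ⟨ε / 2, by positivity, fun x hx => h ?_⟩
  rw [Metric.mem_ball, EuclideanSpace.dist_eq, Real.sqrt_lt' hε, Fin.sum_univ_two]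
  have h0 := hx 0
  have h1 := hx 1
  rw [Real.dist_eq, Real.dist_eq]
  nlinarith [abs_nonneg (x 0 - c 0), abs_nonneg (x 1 - c 1)]

/-- The open square with centre `c` and half side `d`. -/
def openSquare (c : R2) (d : ℝ) : Set R2 := {x | ∀ k, |x k - c k| < d}

lemma isOpen_openSquare (c : R2) (d : ℝ) : IsOpen (openSquare c d) := by
  simp only [openSquare, ofPred_forall]
  refine isOpen_iInter_of_finite fun k => ?_
  have : Continuous fun x : R2 => |x k - c k| := by fun_prop
  exact isOpen_lt this continuous_const

/-- Uniform convergence of polynomials and of their Laplacians on a square implies uniform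
convergence of the gradients on a smaller square. -/
lemma cauchySeq_pderiv {c : R2} {d : ℝ} (hd : 0 < d) [CompactSpace (closedSquare c (2 * d))]
    [CompactSpace (closedSquare c d)] {P : ℕ → MvPolynomial (Fin 2) ℝ}
    (h1 : CauchySeq fun n => polyRestrict (closedSquare c (2 * d)) (P n))
    (h2 : CauchySeq fun n => polyRestrict (closedSquare c (2 * d)) (polyLap (P n))) (i : Fin 2) :
    CauchySeq fun n => polyRestrict (closedSquare c d) (pderiv i (P n)) := by
  have key : ∀ P : MvPolynomial (Fin 2) ℝ, ‖polyRestrict (closedSquare c d) (pderiv i P)‖ ≤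
      2 * ‖polyRestrict (closedSquare c (2 * d)) P‖ / d +
        ‖polyRestrict (closedSquare c (2 * d)) (polyLap P)‖ * d / 2 := by
    intro P
    rw [ContinuousMap.norm_le _ (by positivity)]
    intro x
    have hsub : ∀ y ∈ closedSquare (x : R2) d, y ∈ closedSquare c (2 * d) := by
      intro y hy k
      have := abs_sub_le (y k) ((x : R2) k) (c k)
      linarith [hy k, x.2 k]
    rw [polyRestrict_apply, Real.norm_eq_abs]
    refine abs_pev_pderiv_le hd (fun y hy => ?_) (fun y hy => ?_) i
    · simpa only [polyRestrict_apply, Real.norm_eq_abs] using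
        (polyRestrict (closedSquare c (2 * d)) P).norm_coe_le_norm ⟨y, hsub y hy⟩
    · simpa only [polyRestrict_apply, Real.norm_eq_abs] using
        (polyRestrict (closedSquare c (2 * d)) (polyLap P)).norm_coe_le_norm ⟨y, hsub y hy⟩
  rw [Metric.cauchySeq_iff] at h1 h2 ⊢
  intro ε hε
  obtain ⟨N1, hN1⟩ := h1 (ε * d / 4) (by positivity)
  obtain ⟨N2, hN2⟩ := h2 (ε / d) (by positivity)
  refine ⟨max N1 N2, fun m hm n hn => ?_⟩
  have e1 := hN1 m (le_of_max_le_left hm) n (le_of_max_le_left hn)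
  have e2 := hN2 m (le_of_max_le_right hm) n (le_of_max_le_right hn)
  have e3 := key (P m - P n)
  simp only [dist_eq_norm, ← map_sub] at e1 e2 ⊢
  refine e3.trans_lt ?_
  have e4 : 2 * ‖polyRestrict (closedSquare c (2 * d)) (P m - P n)‖ / d < ε / 2 := by
    rw [div_lt_iff₀ hd]
    linarith
  rw [lt_div_iff₀ hd] at e2
  linarith

/-- Restriction to a smaller set preserves uniform convergence of polynomials. -/
lemma cauchySeq_polyRestrict_mono {Q Q' : Set R2} [CompactSpace Q] [CompactSpace Q'] (h : Q ⊆ Q')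
    {P : ℕ → MvPolynomial (Fin 2) ℝ} (hP : CauchySeq fun n => polyRestrict Q' (P n)) :
    CauchySeq fun n => polyRestrict Q (P n) := by
  obtain ⟨f, hf⟩ := cauchySeq_tendsto_of_complete hP
  have hc := (ContinuousMap.continuous_precomp
    (⟨inclusion h, continuous_inclusion h⟩ : C(Q, Q'))).tendsto f
  refine Tendsto.cauchySeq (x := f.comp ⟨inclusion h, continuous_inclusion h⟩) ?_
  refine (hc.comp hf).congr fun n => ?_
  ext x
  simp [polyRestrict_apply]

/-- Truncated exponential series. -/
def expTrunc {A : Type*} [Ring A] [Algebra ℝ A] (n : ℕ) (a : A) : A :=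
  ∑ k ∈ Finset.range n, ((k.factorial : ℝ)⁻¹) • a ^ k

lemma map_expTrunc {A B : Type*} [Ring A] [Algebra ℝ A] [Ring B] [Algebra ℝ B] (φ : A →ₐ[ℝ] B)
    (n : ℕ) (a : A) : φ (expTrunc n a) = expTrunc n (φ a) := by
  simp [expTrunc]

lemma pderiv_expTrunc_succ (n : ℕ) (P : MvPolynomial (Fin 2) ℝ) (i : Fin 2) :
    pderiv i (expTrunc (n + 1) P) = expTrunc n P * pderiv i P := by
  rw [expTrunc, expTrunc, Finset.sum_range_succ', map_add, map_sum, Finset.sum_mul]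
  simp only [Derivation.map_smul, Derivation.leibniz_pow, pow_zero, Derivation.map_one_eq_zero,
    smul_zero, add_zero]
  refine Finset.sum_congr rfl fun k _ => ?_
  rw [Nat.add_sub_cancel, ← Nat.cast_smul_eq_nsmul ℝ, smul_smul, smul_mul_assoc, smul_eq_mul]
  congr 1
  rw [Nat.factorial_succ]
  push_cast
  have : (k.factorial : ℝ) ≠ 0 := by positivity
  field_simp

lemma tendsto_expTrunc {A : Type*} [NormedRing A] [NormedAlgebra ℝ A] [CompleteSpace A]
    {a : ℕ → A} {b : A} (h : Tendsto a atTop (nhds b)) :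
    Tendsto (fun n => expTrunc n (a n)) atTop (nhds (NormedSpace.exp b)) := by
  have e1 : ∀ n, expTrunc n (a n) =
      ∑' k, if k ∈ Finset.range n then ((k.factorial : ℝ)⁻¹) • a n ^ k else 0 := by
    intro n
    rw [tsum_eq_sum (s := Finset.range n)]
    · exact Finset.sum_congr rfl fun k hk => by rw [if_pos hk]
    · intro k hk
      rw [if_neg hk]
  have e2 : NormedSpace.exp b = ∑' k : ℕ, ((k.factorial : ℝ)⁻¹) • b ^ k := by
    rw [NormedSpace.exp_eq_tsum ℝ]
  simp only [e1, e2]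
  set R := ‖b‖ + 1
  have hR : ∀ᶠ n in atTop, ‖a n‖ ≤ R :=
    (h.norm.eventually (gt_mem_nhds (lt_add_one ‖b‖))).mono fun n hn => le_of_lt hn
  refine tendsto_tsum_of_dominated_convergence
    (bound := fun k : ℕ => (‖(1 : A)‖ + 1) * (R ^ k / k.factorial)) ?_ ?_ ?_
  · exact (Real.summable_pow_div_factorial R).mul_left _
  · intro k
    refine ((h.pow k).const_smul ((k.factorial : ℝ)⁻¹)).congr' ?_
    filter_upwards [eventually_gt_atTop k] with n hn
    rw [if_pos (Finset.mem_range.2 hn)]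
  · filter_upwards [hR] with n hn k
    have hR0 : 0 ≤ R := by positivity
    have hpow : ‖a n ^ k‖ ≤ (‖(1 : A)‖ + 1) * R ^ k := by
      rcases Nat.eq_zero_or_pos k with rfl | hk
      · simp
      · calc ‖a n ^ k‖ ≤ ‖a n‖ ^ k := norm_pow_le' _ hk
          _ ≤ R ^ k := by gcongr
          _ ≤ (‖(1 : A)‖ + 1) * R ^ k :=
            le_mul_of_one_le_left (by positivity) (by linarith [norm_nonneg (1 : A)])
    split_ifs
    · rw [norm_smul, norm_inv, Real.norm_natCast, ← mul_div_assoc, div_eq_inv_mul]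
      gcongr
    · rw [norm_zero]
      positivity

/-- The exponential of a real continuous function. -/
def expMap {X : Type*} [TopologicalSpace X] (f : C(X, ℝ)) : C(X, ℝ) :=
  ⟨fun x => Real.exp (f x), by fun_prop⟩

lemma exp_eq_expMap {X : Type*} [TopologicalSpace X] [CompactSpace X] (f : C(X, ℝ)) :
    NormedSpace.exp f = expMap f := by
  ext x
  have h := NormedSpace.map_exp (ContinuousMap.evalAlgHom ℝ ℝ x)
    (show Continuous fun f : C(X, ℝ) => f x by fun_prop) f
  simp only [ContinuousMap.evalAlgHom_apply] at h
  rw [h, ← Real.exp_eq_exp_ℝ]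
  rfl

/-- Extension by zero. -/
def zeroExt {Q : Set R2} (f : C(Q, ℝ)) : R2 → ℝ := Function.extend Subtype.val f 0

lemma zeroExt_apply {Q : Set R2} (f : C(Q, ℝ)) {x : R2} (hx : x ∈ Q) :
    zeroExt f x = f ⟨x, hx⟩ :=
  Subtype.val_injective.extend_apply f 0 ⟨x, hx⟩

lemma continuousOn_zeroExt {Q : Set R2} (f : C(Q, ℝ)) : ContinuousOn (zeroExt f) Q := by
  rw [continuousOn_iff_continuous_domRestrict]
  refine f.continuous.congr fun x => ?_
  rw [domRestrict_apply, zeroExt_apply f x.2]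

lemma tendstoUniformlyOn_zeroExt {Q : Set R2} [CompactSpace Q] {P : ℕ → MvPolynomial (Fin 2) ℝ}
    {f : C(Q, ℝ)} (h : Tendsto (fun n => polyRestrict Q (P n)) atTop (nhds f)) :
    TendstoUniformlyOn (fun n => pev (P n)) (zeroExt f) atTop Q := by
  rw [ContinuousMap.tendsto_iff_tendstoUniformly] at h
  rw [tendstoUniformlyOn_iff_tendstoUniformly_comp_coe]
  convert h using 1
  · ext n x
    simp [polyRestrict_apply]
  · ext x
    exact zeroExt_apply f x.2

lemma hasFDerivAt_of_tendsto_pev {V : Set R2} (hV : IsOpen V) {P : ℕ → MvPolynomial (Fin 2) ℝ}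
    {w : R2 → ℝ} {D : Fin 2 → R2 → ℝ} (hw : TendstoUniformlyOn (fun n => pev (P n)) w atTop V)
    (hD : ∀ i, TendstoUniformlyOn (fun n => pev (pderiv i (P n))) (D i) atTop V) :
    ∀ x ∈ V, HasFDerivAt w (∑ k : Fin 2, D k x • (EuclideanSpace.proj k : R2 →L[ℝ] ℝ)) x := by
  intro x hx
  have hu : ∀ i, TendstoUniformlyOn
      (fun n y => pev (pderiv i (P n)) y • (EuclideanSpace.proj i : R2 →L[ℝ] ℝ))
      (fun y => D i y • (EuclideanSpace.proj i : R2 →L[ℝ] ℝ)) atTop V := fun i =>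
    (((ContinuousLinearMap.id ℝ ℝ).smulRight
      (EuclideanSpace.proj i : R2 →L[ℝ] ℝ)).uniformContinuous).comp_tendstoUniformlyOn (hD i)
  refine hasFDerivAt_of_tendstoUniformlyOn hV
    (f' := fun n y => ∑ k : Fin 2, pev (pderiv k (P n)) y • (EuclideanSpace.proj k : R2 →L[ℝ] ℝ))
    (g' := fun y => ∑ k : Fin 2, D k y • (EuclideanSpace.proj k : R2 →L[ℝ] ℝ)) ?_
    (fun n y _ => hasFDerivAt_pev (P n) y) (fun y hy => hw.tendsto_at hy) hx
  simp only [Fin.sum_univ_two]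
  exact (hu 0).add (hu 1)

lemma contDiffOn_succ_of_hasFDerivAt {V : Set R2} (hV : IsOpen V) (n : ℕ) {w : R2 → ℝ}
    {D : Fin 2 → R2 → ℝ}
    (hw : ∀ x ∈ V, HasFDerivAt w (∑ k : Fin 2, D k x • (EuclideanSpace.proj k : R2 →L[ℝ] ℝ)) x)
    (hD : ∀ i, ContDiffOn ℝ n (D i) V) : ContDiffOn ℝ (n + 1) w V := by
  rw [contDiffOn_succ_iff_fderiv_of_isOpen hV]
  refine ⟨fun x hx => (hw x hx).differentiableAt.differentiableWithinAt, by simp, ?_⟩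
  refine ContDiffOn.congr (f := fun x => ∑ k : Fin 2, D k x •
    (EuclideanSpace.proj k : R2 →L[ℝ] ℝ)) ?_ fun x hx => (hw x hx).fderiv
  exact ContDiffOn.sum fun k _ => (hD k).smul contDiffOn_const

/-- Local regularity: a uniform limit of polynomials whose Laplacians converge uniformly, together
with their first derivatives, is twice continuously differentiable. -/
lemma contDiffOn_lap_of_cauchySeq {c : R2} {d : ℝ} (hd : 0 < d)
    [CompactSpace (closedSquare c (2 * (2 * d)))] {P : ℕ → MvPolynomial (Fin 2) ℝ} {w f : R2 → ℝ}
    (hw : TendstoUniformlyOn (fun n => pev (P n)) w atTop (closedSquare c (2 * (2 * d))))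
    (hP : CauchySeq fun n => polyRestrict (closedSquare c (2 * (2 * d))) (P n))
    (hf : ∀ x ∈ openSquare c d, Tendsto (fun n => pev (polyLap (P n)) x) atTop (nhds (f x)))
    (hl : CauchySeq fun n => polyRestrict (closedSquare c (2 * (2 * d))) (polyLap (P n)))
    (hl' : ∀ i [CompactSpace (closedSquare c (2 * d))],
      CauchySeq fun n => polyRestrict (closedSquare c (2 * d)) (pderiv i (polyLap (P n)))) :
    ContDiffOn ℝ 2 w (openSquare c d) ∧ ∀ x ∈ openSquare c d, lap w x = f x := by
  have : CompactSpace (closedSquare c d) :=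
    isCompact_iff_compactSpace.1 (isCompact_closedSquare c d)
  have : CompactSpace (closedSquare c (2 * d)) :=
    isCompact_iff_compactSpace.1 (isCompact_closedSquare c (2 * d))
  have hVQ : openSquare c d ⊆ closedSquare c d := fun x hx k => (hx k).le
  have hQ1 : closedSquare c d ⊆ closedSquare c (2 * d) := fun x hx k => (hx k).trans (by linarith)
  have hQ2 : closedSquare c (2 * d) ⊆ closedSquare c (2 * (2 * d)) :=
    fun x hx k => (hx k).trans (by linarith)
  have hV := isOpen_openSquare c d
  have h1 : ∀ i, CauchySeq fun n => polyRestrict (closedSquare c (2 * d)) (pderiv i (P n)) :=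
    fun i => cauchySeq_pderiv (by positivity) hP hl i
  have h2 : ∀ i j, CauchySeq fun n =>
      polyRestrict (closedSquare c d) (pderiv j (pderiv i (P n))) := by
    intro i j
    refine cauchySeq_pderiv hd (h1 i) ?_ j
    simpa only [pderiv_polyLap] using hl' i
  choose G hG using fun i => cauchySeq_tendsto_of_complete (h1 i)
  choose H hH using fun i j => cauchySeq_tendsto_of_complete (h2 i j)
  have uG : ∀ i, TendstoUniformlyOn (fun n => pev (pderiv i (P n))) (zeroExt (G i)) atTop
      (openSquare c d) := fun i => (tendstoUniformlyOn_zeroExt (hG i)).mono (hVQ.trans hQ1)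
  have uH : ∀ i j, TendstoUniformlyOn (fun n => pev (pderiv j (pderiv i (P n))))
      (zeroExt (H i j)) atTop (openSquare c d) := fun i j =>
    (tendstoUniformlyOn_zeroExt (hH i j)).mono hVQ
  have dw := hasFDerivAt_of_tendsto_pev hV (hw.mono ((hVQ.trans hQ1).trans hQ2)) uG
  have dG := fun i => hasFDerivAt_of_tendsto_pev hV (uG i) (uH i)
  refine ⟨?_, fun x hx => ?_⟩
  · have := contDiffOn_succ_of_hasFDerivAt hV 1 dw fun i => by
      have := contDiffOn_succ_of_hasFDerivAt hV 0 (dG i) fun j =>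
        contDiffOn_zero.2 ((continuousOn_zeroExt (H i j)).mono hVQ)
      simpa using this
    norm_num at this
    exact this
  · rw [lap_eq_of_hasFDerivAt (d2 := fun i j => zeroExt (H i j) x)
      ((hV.eventually_mem hx).mono dw) fun i => dG i x hx]
    refine tendsto_nhds_unique ?_ (hf x hx)
    have : ∀ n, pev (polyLap (P n)) x = ∑ i, pev (pderiv i (pderiv i (P n))) x := fun n => by
      simp [polyLap_apply, pev]
    simp only [this]
    exact tendsto_finsetSum _ fun i _ => (uH i i).tendsto_at hx

/-- Fixed points of the integral form of `-Δu = c eᵘ` are classical solutions. -/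
lemma regularity_of_fixedPoint {α : ℝ} [CompactSpace (ellipseC α)]
    {T : MvPolynomial (Fin 2) ℝ → MvPolynomial (Fin 2) ℝ}
    {S : C(ellipseC α, ℝ) →L[ℝ] C(ellipseC α, ℝ)} (hT : ∀ f, polyLap (T f) = -f)
    (hS : ∀ f, S (polyRestrict _ f) = polyRestrict _ (T f)) {u : C(ellipseC α, ℝ)} {a : ℝ}
    (hu : S (a • expMap u) = u) :
    ContDiffOn ℝ 2 (zeroExt u) (ellipseO α) ∧
      ∀ x ∈ ellipseO α, lap (zeroExt u) x = -(a * Real.exp (zeroExt u x)) := by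
  have hdense := denseRange_polyRestrict (ellipseC α)
  obtain ⟨b, hb1, hb2⟩ := mem_closure_iff_seq_limit.1 (hdense (a • expMap u))
  choose f hf using hb1
  obtain rfl : (fun n => polyRestrict (ellipseC α) (f n)) = b := funext hf
  have hU : Tendsto (fun n => polyRestrict (ellipseC α) (T (f n))) atTop (nhds u) := by
    have := (S.continuous.tendsto _).comp hb2
    rw [hu] at this
    exact this.congr fun n => hS (f n)
  let g : ℕ → MvPolynomial (Fin 2) ℝ := fun n => a • expTrunc (n + 1) (T (f n))
  have hg : Tendsto (fun n => polyRestrict (ellipseC α) (g n)) atTop (nhds (a • expMap u)) := by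
    have hshift := tendsto_expTrunc (a := fun n => polyRestrict (ellipseC α) (T (f (n - 1))))
      (hU.comp (tendsto_sub_atTop_nat 1))
    have := (hshift.comp (tendsto_add_atTop_nat 1)).const_smul a
    rw [exp_eq_expMap] at this
    refine this.congr fun n => ?_
    simp [g, map_expTrunc]
  have hW : Tendsto (fun n => polyRestrict (ellipseC α) (T (g n))) atTop (nhds u) := by
    have := (S.continuous.tendsto _).comp hg
    rw [hu] at this
    exact this.congr fun n => hS (g n)
  have hlocal : ∀ x ∈ ellipseO α, ∃ V, IsOpen V ∧ x ∈ V ∧ ContDiffOn ℝ 2 (zeroExt u) V ∧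
      ∀ y ∈ V, lap (zeroExt u) y = -(a * Real.exp (zeroExt u y)) := by
    intro x hx
    obtain ⟨d, hd, hsub⟩ := exists_closedSquare_subset (isOpen_ellipseO α) hx
    obtain ⟨e, rfl⟩ : ∃ e, d = 2 * (2 * e) := ⟨d / 4, by ring⟩
    have he : 0 < e := by linarith
    have : CompactSpace (closedSquare x (2 * (2 * e))) :=
      isCompact_iff_compactSpace.1 (isCompact_closedSquare _ _)
    have hsubC := hsub.trans (ellipseO_subset_ellipseC α)
    have hVsub : openSquare x e ⊆ ellipseC α :=
      fun y hy => hsubC fun k => (hy k).le.trans (by linarith)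
    refine ⟨openSquare x e, isOpen_openSquare x e, fun k => by simpa using he,
      contDiffOn_lap_of_cauchySeq (P := fun n => T (g n)) he
        ((tendstoUniformlyOn_zeroExt hW).mono hsubC)
        (cauchySeq_polyRestrict_mono hsubC hW.cauchySeq) (fun y hy => ?_) ?_ ?_⟩
    · have h := (tendstoUniformlyOn_zeroExt hg).tendsto_at (hVsub hy)
      rw [zeroExt_apply _ (hVsub hy)] at h ⊢
      simp only [hT]
      refine h.neg.congr fun n => ?_
      simp [pev]
    · simp only [hT, map_neg]
      exact (cauchySeq_polyRestrict_mono hsubC hg.cauchySeq).neg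
    · intro i _
      have hsub2 : closedSquare x (2 * e) ⊆ ellipseC α :=
        fun y hy => hsubC fun k => (hy k).trans (by linarith)
      have hpd : CauchySeq fun n =>
          polyRestrict (closedSquare x (2 * e)) (pderiv i (T (f n))) := by
        refine cauchySeq_pderiv (by positivity)
          (cauchySeq_polyRestrict_mono hsubC hU.cauchySeq) ?_ i
        simp only [hT, map_neg]
        exact (cauchySeq_polyRestrict_mono hsubC hb2.cauchySeq).neg
      obtain ⟨D, hD⟩ := cauchySeq_tendsto_of_complete hpd
      obtain ⟨v, hv⟩ := cauchySeq_tendsto_of_complete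
        (cauchySeq_polyRestrict_mono hsub2 hU.cauchySeq)
      have hprod := (((tendsto_expTrunc hv).mul hD).const_smul a).neg
      refine (hprod.congr fun n => ?_).cauchySeq
      simp only [hT, g, map_neg, Derivation.map_smul, map_smul, pderiv_expTrunc_succ, map_mul,
        map_expTrunc]
  refine ⟨fun x hx => ?_, fun x hx => ?_⟩
  · obtain ⟨V, hV, hxV, hc, -⟩ := hlocal x hx
    exact (hc.contDiffAt (hV.mem_nhds hxV)).contDiffWithinAt
  · obtain ⟨V, -, hxV, -, hl⟩ := hlocal x hx
    exact hl x hxV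

lemma volume_ellipseO {α : ℝ} (hα : 0 < α) : volume (ellipseO α) = ENNReal.ofReal (π / α) := by
  let f : R2 →ₗ[ℝ] R2 := Matrix.toEuclideanLin (Matrix.diagonal ![α, 1])
  have hdet : LinearMap.det f = α := by
    simp only [f, Matrix.toLpLin_eq_toLin, LinearMap.det_toLin, Matrix.det_diagonal]
    simp
  have hpre : ellipseO α = f ⁻¹' Metric.ball 0 1 := by
    ext x
    simp only [ellipseO, mem_ofPred_eq, mem_preimage, Metric.mem_ball, dist_zero_right,
      EuclideanSpace.norm_eq, Fin.sum_univ_two]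
    rw [Real.sqrt_lt' one_pos]
    simp [f, Matrix.toLpLin_apply, mul_pow]
  rw [hpre, Measure.addHaar_preimage_linearMap _ (by rw [hdet]; exact hα.ne'), hdet,
    EuclideanSpace.volume_ball_fin_two, abs_of_pos (inv_pos.2 hα), div_eq_inv_mul,
    ENNReal.ofReal_mul (inv_pos.2 hα).le]
  simp [ENNReal.ofReal, Real.toNNReal_of_nonneg Real.pi_pos.le]

lemma volume_real_ellipseO {α : ℝ} (hα : 0 < α) : volume.real (ellipseO α) = π / α := by
  rw [Measure.real, volume_ellipseO hα, ENNReal.toReal_ofReal (by positivity)]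

/-- The mass `∫ eᵘ` over the ellipse. -/
def expMass {α : ℝ} (u : C(ellipseC α, ℝ)) : ℝ := ∫ x in ellipseO α, Real.exp (zeroExt u x)

lemma integrableOn_exp_zeroExt {α : ℝ} (hα : 0 < α) (u : C(ellipseC α, ℝ)) :
    IntegrableOn (fun x => Real.exp (zeroExt u x)) (ellipseO α) :=
  ((continuousOn_zeroExt u).rexp.integrableOn_compact (isCompact_ellipseC hα)).mono_set
    (ellipseO_subset_ellipseC α)

lemma abs_exp_sub_exp_le {a b : ℝ} (ha : |a| ≤ 1) (hb : |b| ≤ 1) :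
    |Real.exp a - Real.exp b| ≤ Real.exp 1 * |a - b| := by
  have key : ∀ s t : ℝ, |s| ≤ 1 → Real.exp s - Real.exp t ≤ Real.exp 1 * |s - t| := by
    intro s t hs
    have h1 := Real.add_one_le_exp (t - s)
    have h2 : Real.exp t = Real.exp s * Real.exp (t - s) := by rw [← Real.exp_add]; ring_nf
    have h3 : Real.exp s ≤ Real.exp 1 := Real.exp_le_exp.2 ((le_abs_self s).trans hs)
    calc Real.exp s - Real.exp t = Real.exp s * (1 - Real.exp (t - s)) := by rw [h2]; ring
      _ ≤ Real.exp s * |s - t| := by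
        gcongr
        linarith [le_abs_self (s - t)]
      _ ≤ Real.exp 1 * |s - t| := by gcongr
  rw [abs_le]
  have h1 := key a b ha
  have h2 := key b a hb
  rw [abs_sub_comm b a] at h2
  constructor <;> linarith

lemma zeroExt_abs_le {Q : Set R2} [CompactSpace Q] (u : C(Q, ℝ)) {x : R2} (hx : x ∈ Q) :
    |zeroExt u x| ≤ ‖u‖ := by
  rw [zeroExt_apply u hx]
  exact u.norm_coe_le_norm ⟨x, hx⟩

lemma expMass_ge {α : ℝ} (hα : 0 < α) [CompactSpace (ellipseC α)] {u : C(ellipseC α, ℝ)}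
    (hu : ‖u‖ ≤ 1) : π / α / Real.exp 1 ≤ expMass u := by
  have hvol : volume (ellipseO α) ≠ ⊤ := by rw [volume_ellipseO hα]; exact ENNReal.ofReal_ne_top
  have h := setIntegral_mono_on (f := fun _ => Real.exp (-1))
    (integrableOn_const hvol) (integrableOn_exp_zeroExt hα u)
    (isOpen_ellipseO α).measurableSet fun x hx => Real.exp_le_exp.2
      (abs_le.1 ((zeroExt_abs_le u (ellipseO_subset_ellipseC α hx)).trans hu)).1
  rw [setIntegral_const, volume_real_ellipseO hα, smul_eq_mul, Real.exp_neg] at h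
  exact h

lemma abs_expMass_sub_le {α : ℝ} (hα : 0 < α) [CompactSpace (ellipseC α)]
    {u v : C(ellipseC α, ℝ)} (hu : ‖u‖ ≤ 1) (hv : ‖v‖ ≤ 1) :
    |expMass u - expMass v| ≤ Real.exp 1 * ‖u - v‖ * (π / α) := by
  have hvol : volume (ellipseO α) < ⊤ := by rw [volume_ellipseO hα]; exact ENNReal.ofReal_lt_top
  unfold expMass
  rw [← integral_sub (integrableOn_exp_zeroExt hα u) (integrableOn_exp_zeroExt hα v),
    ← volume_real_ellipseO hα, ← Real.norm_eq_abs]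
  refine norm_setIntegral_le_of_norm_le_const hvol fun x hx => ?_
  have hxC := ellipseO_subset_ellipseC α hx
  refine (abs_exp_sub_exp_le ((zeroExt_abs_le u hxC).trans hu)
    ((zeroExt_abs_le v hxC).trans hv)).trans ?_
  gcongr
  rw [zeroExt_apply u hxC, zeroExt_apply v hxC]
  exact (u - v).norm_coe_le_norm ⟨x, hxC⟩

/-- The nonlinearity `λ eᵘ / ∫ eᵘ` of the mean field equation. -/
def meanField {α : ℝ} (lam : ℝ) (u : C(ellipseC α, ℝ)) : C(ellipseC α, ℝ) :=
  (lam / expMass u) • expMap u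

lemma meanField_zero {α : ℝ} (hα : 0 < α) (lam : ℝ) :
    meanField lam (0 : C(ellipseC α, ℝ)) = algebraMap ℝ _ (lam * α / π) := by
  have hm : expMass (0 : C(ellipseC α, ℝ)) = π / α := by
    have : ∀ x, zeroExt (0 : C(ellipseC α, ℝ)) x = 0 := by
      intro x
      by_cases hx : x ∈ ellipseC α
      · rw [zeroExt_apply _ hx]
        rfl
      · exact Function.extend_apply' _ _ _ (by simpa using hx)
    simp [expMass, this, volume_real_ellipseO hα]
  ext x
  simp [meanField, hm, expMap, div_div_eq_mul_div]

lemma norm_meanField_sub_le {α : ℝ} (hα : 0 < α) [CompactSpace (ellipseC α)] {lam : ℝ}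
    (hlam : 0 < lam) {u v : C(ellipseC α, ℝ)} (hu : ‖u‖ ≤ 1) (hv : ‖v‖ ≤ 1) :
    ‖meanField lam u - meanField lam v‖ ≤
      lam * α / π * (Real.exp 1 ^ 2 + Real.exp 1 ^ 4) * ‖u - v‖ := by
  rw [ContinuousMap.norm_le _ (by positivity)]
  intro x
  set E := Real.exp 1 with hE
  set A := π / α with hA
  set δ := ‖u - v‖ with hδ
  have hEp : 0 < E := Real.exp_pos 1
  have hAp : 0 < A := by positivity
  have hIu : A / E ≤ expMass u := expMass_ge hα hu
  have hIv : A / E ≤ expMass v := expMass_ge hα hv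
  have hIup : 0 < expMass u := lt_of_lt_of_le (by positivity) hIu
  have hIvp : 0 < expMass v := lt_of_lt_of_le (by positivity) hIv
  have hux : |u x| ≤ 1 := (u.norm_coe_le_norm x).trans hu
  have hvx : |v x| ≤ 1 := (v.norm_coe_le_norm x).trans hv
  have h1 : |Real.exp (u x) - Real.exp (v x)| ≤ E * δ :=
    (abs_exp_sub_exp_le hux hvx).trans (by gcongr; exact (u - v).norm_coe_le_norm x)
  have h2 : |expMass v - expMass u| ≤ E * δ * A := by
    rw [abs_sub_comm]
    exact abs_expMass_sub_le hα hu hv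
  have h3 : Real.exp (v x) ≤ E := Real.exp_le_exp.2 ((le_abs_self _).trans hvx)
  have hinv : ∀ I, A / E ≤ I → 0 < I → 1 / I ≤ E / A := by
    intro I hI hI0
    rw [div_le_div_iff₀ hI0 hAp, one_mul]
    rw [div_le_iff₀ hEp] at hI
    linarith
  have e : (meanField lam u - meanField lam v) x =
      lam * ((Real.exp (u x) - Real.exp (v x)) * (1 / expMass u) +
        Real.exp (v x) * (expMass v - expMass u) * ((1 / expMass u) * (1 / expMass v))) := by
    simp only [meanField, expMap, ContinuousMap.sub_apply, ContinuousMap.smul_apply,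
      ContinuousMap.coe_mk, smul_eq_mul]
    field_simp
    ring
  rw [e, Real.norm_eq_abs, abs_mul, abs_of_pos hlam]
  have hb : |(Real.exp (u x) - Real.exp (v x)) * (1 / expMass u) +
        Real.exp (v x) * (expMass v - expMass u) * ((1 / expMass u) * (1 / expMass v))| ≤
      E * δ * (E / A) + E * (E * δ * A) * ((E / A) * (E / A)) := by
    refine (abs_add_le _ _).trans (add_le_add ?_ ?_)
    · rw [abs_mul, abs_of_pos (one_div_pos.2 hIup)]
      exact mul_le_mul h1 (hinv _ hIu hIup) (by positivity) (by positivity)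
    · rw [abs_mul, abs_mul, abs_of_pos (Real.exp_pos _),
        abs_of_pos (mul_pos (one_div_pos.2 hIup) (one_div_pos.2 hIvp))]
      exact mul_le_mul (mul_le_mul h3 h2 (abs_nonneg _) hEp.le)
        (mul_le_mul (hinv _ hIu hIup) (hinv _ hIv hIvp) (by positivity) (by positivity))
        (by positivity) (by positivity)
  refine (mul_le_mul_of_nonneg_left hb hlam.le).trans (le_of_eq ?_)
  rw [hA]
  field_simp

lemma closure_ellipseO_subset (α : ℝ) : closure (ellipseO α) ⊆ ellipseC α :=
  closure_minimal (ellipseO_subset_ellipseC α) (isClosed_ellipseC α)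

/-- Existence, and closeness to the leading term, for a fixed small aspect ratio. -/
lemma exists_isSolP {α lam : ℝ} (hα : 0 < α) (hlam : 0 < lam)
    (hk : lam * α / π * (Real.exp 1 ^ 2 + Real.exp 1 ^ 4) ≤ 1) :
    ∃ u : R2 → ℝ, IsSolP (ellipseO α) lam u ∧ ∀ p ∈ ellipseO α,
      |u p - lam * α / (2 * π) * (1 - α ^ 2 * p 0 ^ 2 - p 1 ^ 2)| ≤
        1 / 2 * ((lam * α / π * (Real.exp 1 ^ 2 + Real.exp 1 ^ 4)) ^ 2 + lam * α / π * α ^ 2) := by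
  have : CompactSpace (ellipseC α) := isCompact_iff_compactSpace.1 (isCompact_ellipseC hα)
  obtain ⟨T, S, hT, hTS, hS, hS0, hSg⟩ := exists_poisson hα
  set k := lam * α / π * (Real.exp 1 ^ 2 + Real.exp 1 ^ 4) with hkdef
  have hk0 : 0 ≤ k := by positivity
  have hstep : ∀ u v : C(ellipseC α, ℝ), ‖u‖ ≤ 1 → ‖v‖ ≤ 1 →
      ‖S (meanField lam u) - S (meanField lam v)‖ ≤ 1 / 2 * k * ‖u - v‖ := by
    intro u v hu hv
    rw [← map_sub]
    refine (hS _).trans ?_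
    rw [mul_assoc]
    gcongr
    exact norm_meanField_sub_le hα hlam hu hv
  have hzero : ‖S (meanField lam (0 : C(ellipseC α, ℝ)))‖ ≤ 1 / 2 * k := by
    refine (hS _).trans ?_
    gcongr
    rw [meanField_zero hα, ContinuousMap.norm_le _ hk0]
    intro x
    have hpos : 0 < lam * α / π := by positivity
    have hE : 1 ≤ Real.exp 1 ^ 2 := one_le_pow₀ (Real.one_le_exp zero_le_one)
    have hE4 : 0 < Real.exp 1 ^ 4 := by positivity
    rw [algebraMap_apply, smul_eq_mul, mul_one, Real.norm_eq_abs, abs_of_pos hpos]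
    exact le_mul_of_one_le_right hpos.le (by linarith)
  have hball : ∀ u : C(ellipseC α, ℝ), ‖u‖ ≤ 1 → ‖S (meanField lam u)‖ ≤ k := by
    intro u hu
    have h1 := hstep u 0 hu (by simp)
    have h2 := norm_le_norm_add_norm_sub' (S (meanField lam u)) (S (meanField lam 0))
    rw [sub_zero] at h1
    have h3 : 1 / 2 * k * ‖u‖ ≤ 1 / 2 * k * 1 := by gcongr
    linarith
  have hmaps : MapsTo (fun u => S (meanField lam u)) (Metric.closedBall (0 : C(ellipseC α, ℝ)) 1)
      (Metric.closedBall 0 1) := by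
    intro u hu
    rw [mem_closedBall_zero_iff] at hu ⊢
    exact (hball u hu).trans hk
  have hcontr : ContractingWith (1 / 2) (hmaps.restrict _ _ _) := by
    refine ⟨by rw [← NNReal.coe_lt_coe]; norm_num, LipschitzWith.of_dist_le_mul ?_⟩
    rintro ⟨u, hu⟩ ⟨v, hv⟩
    rw [mem_closedBall_zero_iff] at hu hv
    have h := hstep u v hu hv
    simp only [Subtype.dist_eq, MapsTo.val_restrict_apply, dist_eq_norm]
    refine h.trans ?_
    push_cast
    gcongr
    linarith
  obtain ⟨u, hu, hfix, -⟩ := hcontr.exists_fixedPoint' Metric.isClosed_closedBall.isComplete hmaps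
    (Metric.mem_closedBall_self zero_le_one) (edist_ne_top _ _)
  rw [mem_closedBall_zero_iff] at hu
  have hfix' : S (meanField lam u) = u := hfix
  have huk : ‖u‖ ≤ k := by
    rw [← hfix']
    exact hball u hu
  obtain ⟨hC2, hlap⟩ := regularity_of_fixedPoint (a := lam / expMass u) hT hTS hfix'
  refine ⟨zeroExt u, ⟨hC2, (continuousOn_zeroExt u).mono (closure_ellipseO_subset α), ?_, ?_⟩, ?_⟩
  · intro p hp
    rw [(isOpen_ellipseO α).frontier_eq] at hp
    rw [zeroExt_apply u (closure_ellipseO_subset α hp.1), ← hfix']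
    exact hS0 _ _ hp.2
  · intro p hp
    rw [hlap p hp, neg_neg]
    change _ = lam * _ / expMass u
    ring
  · intro p hp
    have hpC := ellipseO_subset_ellipseC α hp
    have hlead : S (algebraMap ℝ _ (lam * α / π * (1 + α ^ 2))) =
        (lam * α / (2 * π)) • polyRestrict _ (ellipsePoly α) := by
      rw [← hSg, ← map_smul]
      congr 1
      ext x
      simp only [algebraMap_apply, ContinuousMap.smul_apply, smul_eq_mul, mul_one]
      field_simp
    have hval : zeroExt u p - lam * α / (2 * π) * (1 - α ^ 2 * p 0 ^ 2 - p 1 ^ 2) =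
        S (meanField lam u - algebraMap ℝ _ (lam * α / π * (1 + α ^ 2))) ⟨p, hpC⟩ := by
      rw [map_sub, hfix', hlead, ContinuousMap.sub_apply, ContinuousMap.smul_apply,
        polyRestrict_apply, pev_ellipsePoly, zeroExt_apply u hpC, smul_eq_mul]
    rw [hval]
    refine ((S _).norm_coe_le_norm _).trans ((hS _).trans ?_)
    gcongr
    have hsplit : meanField lam u - algebraMap ℝ _ (lam * α / π * (1 + α ^ 2)) =
        (meanField lam u - meanField lam 0) -
          algebraMap ℝ C(ellipseC α, ℝ) (lam * α / π * α ^ 2) := by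
      rw [meanField_zero hα, sub_sub, ← map_add]
      ring_nf
    rw [hsplit]
    refine (norm_sub_le _ _).trans (add_le_add ?_ ?_)
    · refine (norm_meanField_sub_le hα hlam hu (by simp)).trans ?_
      rw [sub_zero, pow_two k]
      exact mul_le_mul_of_nonneg_left huk hk0
    · rw [ContinuousMap.norm_le _ (by positivity)]
      intro x
      rw [algebraMap_apply, smul_eq_mul, mul_one, Real.norm_eq_abs,
        abs_of_pos (by positivity)]

/-- Asymptotic expansion of solutions on thin ellipses: for `λ̄ ≥ 8π` there are `α₀ ∈ (0,1)`
and `M > 0` such that for `α < α₀`, `λ < λ̄` there is a solution of `P(λ, ω_α)` which is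
`Mα²`-close to `(λα/(2π))(1 − α²x² − y²)` on `ω_α`. -/
theorem statement11 (lamBar : ℝ) (h : 8 * π ≤ lamBar) :
    ∃ α₀ ∈ Set.Ioo (0 : ℝ) 1, ∃ M : ℝ, 0 < M ∧
      ∀ α ∈ Set.Ioo (0 : ℝ) α₀, ∀ lam ∈ Set.Ioo (0 : ℝ) lamBar,
        ∃ u : R2 → ℝ, IsSolP (ellipseO α) lam u ∧
          ∀ p ∈ ellipseO α,
            |u p - lam * α / (2 * π) * (1 - α ^ 2 * p 0 ^ 2 - p 1 ^ 2)| ≤ M * α ^ 2 := by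
  have hbar : 0 < lamBar := lt_of_lt_of_le (by positivity) h
  set E := Real.exp 1 ^ 2 + Real.exp 1 ^ 4 with hE
  have hEp : 0 < E := by positivity
  refine ⟨min (1 / 2) (π / (lamBar * E)), ⟨by positivity, by
    exact (min_le_left _ _).trans_lt (by norm_num)⟩,
    1 / 2 * ((lamBar / π * E) ^ 2 + lamBar / π), by positivity, ?_⟩
  rintro α ⟨hα, hα0⟩ lam ⟨hlam, hlamBar⟩
  have hα1 : α ≤ 1 := (hα0.trans_le (min_le_left _ _)).le.trans (by norm_num)
  have hα2 : α * (lamBar * E) < π :=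
    (lt_div_iff₀ (by positivity)).1 (hα0.trans_le (min_le_right _ _))
  have hk : lam * α / π * E ≤ lamBar / π * E * α := by
    rw [mul_div_right_comm, mul_right_comm]
    gcongr
  have hk1 : lamBar / π * E * α ≤ 1 := by
    rw [div_mul_eq_mul_div, div_mul_eq_mul_div, div_le_one Real.pi_pos]
    linarith
  obtain ⟨u, hu, hclose⟩ := exists_isSolP hα hlam (hk.trans hk1)
  refine ⟨u, hu, fun p hp => (hclose p hp).trans ?_⟩
  rw [mul_assoc, add_mul, ← mul_pow]
  gcongr
  calc lam * α ≤ lamBar * 1 := by gcongr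
    _ = lamBar := mul_one _
end
end

section
/- Every convex body K ⊂ ℝ² (a compact convex set with nonempty interior) contains an ellipse of area at least (π/(3√3))·A(K), where an ellipse is the image of the closed unit disk under an invertible affine map of ℝ² and A denotes Lebesgue area. -/
open MeasureTheory Real Set Filter

noncomputable section

/-- The linear map `b • id + k • e ⊗ e`. -/
def stretch (b k : ℝ) (e : R2) : R2 →L[ℝ] R2 :=
  b • ContinuousLinearMap.id ℝ R2 + k • (innerSL ℝ e).smulRight e

lemma stretch_apply (b k : ℝ) (e x : R2) :
    stretch b k e x = b • x + (k * inner ℝ e x) • e := by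
  simp [stretch, smul_smul]

lemma det_stretch (b k : ℝ) {e : R2} (he : ‖e‖ = 1) :
    (stretch b k e).det = b * (b + k) := by
  have h1 : e 0 ^ 2 + e 1 ^ 2 = 1 := by
    have := EuclideanSpace.real_norm_sq_eq e
    rw [he, Fin.sum_univ_two] at this
    linarith
  rw [ContinuousLinearMap.det, ← LinearMap.det_toMatrix (EuclideanSpace.basisFun (Fin 2) ℝ).toBasis,
    Matrix.det_fin_two]
  simp [LinearMap.toMatrix_apply, stretch_apply, EuclideanSpace.inner_single_right]
  linear_combination b * k * h1

lemma inner_stretch (b k : ℝ) (e u x : R2) :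
    inner ℝ u (stretch b k e x) = inner ℝ (stretch b k e u) x := by
  simp only [stretch_apply, inner_add_right, inner_add_left, inner_smul_left, inner_smul_right,
    RCLike.conj_to_real, real_inner_comm]
  ring

lemma norm_stretch_sq (b k : ℝ) {e u : R2} (he : ‖e‖ = 1) (hu : ‖u‖ = 1) :
    ‖stretch b k e u‖ ^ 2 = b ^ 2 + ((b + k) ^ 2 - b ^ 2) * inner ℝ u e ^ 2 := by
  rw [stretch_apply, norm_add_sq_real, norm_smul, norm_smul, hu, he, inner_smul_left,
    inner_smul_right, real_inner_comm u e, mul_pow, mul_pow,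
    Real.norm_eq_abs, Real.norm_eq_abs, sq_abs, sq_abs]
  simp only [RCLike.conj_to_real]
  ring

/-- A point outside a nonempty compact convex set is separated from it by a
unit vector. -/
lemma exists_unit_separating {L : Set R2} (hLc : IsCompact L) (hLconv : Convex ℝ L) {x : R2}
    (hL : L.Nonempty) (hx : x ∉ L) : ∃ u : R2, ‖u‖ = 1 ∧ ∀ a ∈ L, inner ℝ u a < inner ℝ u x := by
  obtain ⟨f, c, hf, hc⟩ := geometric_hahn_banach_closed_point hLconv hLc.isClosed hx
  set v := (InnerProductSpace.toDual ℝ R2).symm f with hv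
  have hfv : ∀ y, f y = inner ℝ v y := fun y => by simp [hv]
  obtain ⟨a₀, ha₀⟩ := hL
  have hv0 : v ≠ 0 := by
    intro h
    have h1 := hf a₀ ha₀
    rw [hfv, h, inner_zero_left] at h1 hc
    exact lt_asymm h1 hc
  refine ⟨‖v‖⁻¹ • v, norm_smul_inv_norm hv0, fun a ha => ?_⟩
  rw [real_inner_smul_left, real_inner_smul_left, ← hfv, ← hfv]
  exact mul_lt_mul_of_pos_left ((hf a ha).trans hc) (inv_pos.2 (norm_pos_iff.2 hv0))

/-- `L` is a body in which the unit ball is an ellipse of maximal area. -/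
structure JohnPosition (L : Set R2) : Prop where
  isCompact : IsCompact L
  convex : Convex ℝ L
  closedBall_subset : Metric.closedBall 0 1 ⊆ L
  abs_det_le : ∀ (B : R2 →L[ℝ] R2) (d : R2),
    (∀ x ∈ Metric.closedBall (0 : R2) 1, B x + d ∈ L) → |B.det| ≤ 1

lemma JohnPosition.exists_approx_contact {L : Set R2} (h : JohnPosition L) {e : R2}
    (he : ‖e‖ = 1) {t : ℝ} (ht : 0 < t) (ht1 : t ≤ 1 / 2) :
    ∃ u : R2, ‖u‖ = 1 ∧ 1 / 2 - t ≤ inner ℝ u e ∧ ∀ a ∈ L, inner ℝ u a ≤ 1 + 2 * t := by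
  set s : ℝ := t * (1 / 2 + t) / 2 with hs
  set b : ℝ := √(1 - t * (1 / 2 - t)) with hb
  have hb2 : b ^ 2 = 1 - t * (1 / 2 - t) := Real.sq_sqrt (by nlinarith)
  have hb0 : 0 ≤ b := Real.sqrt_nonneg _
  have hs0 : 0 < s := by positivity
  have hst : s ≤ t := by rw [hs]; nlinarith
  have hb1 : b ≤ 1 := by nlinarith
  have hnot : ¬ ∀ x ∈ Metric.closedBall (0 : R2) 1,
      stretch b (1 + s - b) e x + s • e ∈ L := by
    intro hall
    have h1 := h.abs_det_le _ _ hall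
    rw [det_stretch _ _ he, abs_of_nonneg (by apply mul_nonneg hb0; linarith)] at h1
    have h2 : (b * (b + (1 + s - b))) ^ 2 ≤ 1 := by
      have : 0 ≤ b * (b + (1 + s - b)) := by apply mul_nonneg hb0; linarith
      nlinarith
    have h3 : (b * (b + (1 + s - b))) ^ 2 =
        (1 + t ^ 2) ^ 2 - t ^ 2 / 4 + s ^ 2 * b ^ 2 := by
      have : (b * (b + (1 + s - b))) ^ 2 = b ^ 2 * (1 + 2 * s) + s ^ 2 * b ^ 2 := by ring
      rw [this, hb2, hs]; ring
    nlinarith [sq_nonneg (s * b), pow_pos ht 2, pow_pos ht 4]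
  push Not at hnot
  obtain ⟨x, hx, hxL⟩ := hnot
  have hx1 : ‖x‖ ≤ 1 := by simpa using hx
  obtain ⟨u, hu, hsep⟩ := exists_unit_separating h.isCompact h.convex
    ⟨0, h.closedBall_subset (by simp)⟩ hxL
  set c : ℝ := inner ℝ u e with hc
  have hcabs : |c| ≤ 1 := by
    have := abs_real_inner_le_norm u e
    rwa [hu, he, one_mul] at this
  obtain ⟨hc1, hc2⟩ := abs_le.1 hcabs
  have hN := norm_stretch_sq b (1 + s - b) he hu
  rw [← hc, show b + (1 + s - b) = 1 + s by ring, hb2] at hN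
  set N : ℝ := ‖stretch b (1 + s - b) e u‖ with hNdef
  have hN0 : 0 ≤ N := norm_nonneg _
  have hub : inner ℝ u (stretch b (1 + s - b) e x + s • e) ≤ N + s * c := by
    rw [inner_add_right, inner_stretch, real_inner_smul_right, ← hc]
    have := real_inner_le_norm (stretch b (1 + s - b) e u) x
    rw [← hNdef] at this
    nlinarith
  have hNs : N ≤ 1 + s := by
    have hc3 : c ^ 2 ≤ 1 := by nlinarith
    have : N ^ 2 ≤ (1 + s) ^ 2 := by
      rw [hN]
      have : 0 ≤ (1 + s) ^ 2 - (1 - t * (1 / 2 - t)) := by nlinarith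
      nlinarith
    nlinarith
  refine ⟨u, hu, ?_, fun a ha => ?_⟩
  · have h1 : 1 < N + s * c := by
      have := hsep u (h.closedBall_subset (by simp [hu]))
      rw [real_inner_self_eq_norm_sq, hu] at this
      linarith
    have h2 : 0 ≤ 1 - s * c := by nlinarith
    have h3 : (1 - s * c) ^ 2 < N ^ 2 := by nlinarith
    have h4 : 0 < t * ((c + 1) * (c - (1 / 2 - t))) := by
      rw [hN] at h3
      have : t * ((c + 1) * (c - (1 / 2 - t))) = (1 - t * (1 / 2 - t)) +
        ((1 + s) ^ 2 - (1 - t * (1 / 2 - t))) * c ^ 2 - (1 - s * c) ^ 2 := by rw [hs]; ring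
      linarith
    by_contra hlt
    push Not at hlt
    have : (c + 1) * (c - (1 / 2 - t)) ≤ 0 :=
      mul_nonpos_of_nonneg_of_nonpos (by linarith) (by linarith)
    exact h4.not_ge (mul_nonpos_of_nonneg_of_nonpos ht.le this)
  · have h1 := hsep a ha
    have h2 : s * c ≤ s := mul_le_of_le_one_right hs0.le hc2
    linarith

/-- Every closed arc of the unit circle of length `2π/3` contains a contact point. -/
lemma JohnPosition.exists_contact {L : Set R2} (h : JohnPosition L) {e : R2} (he : ‖e‖ = 1) :
    ∃ u : R2, ‖u‖ = 1 ∧ 1 / 2 ≤ inner ℝ u e ∧ ∀ a ∈ L, inner ℝ u a ≤ 1 := by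
  have hpos : ∀ n : ℕ, (0 : ℝ) < 1 / ((n : ℝ) + 2) := fun n => by positivity
  have hle : ∀ n : ℕ, 1 / ((n : ℝ) + 2) ≤ 1 / 2 := fun n =>
    one_div_le_one_div_of_le two_pos (by linarith [n.cast_nonneg (α := ℝ)])
  choose u hu hue huL using fun n => h.exists_approx_contact he (hpos n) (hle n)
  obtain ⟨v, hv, φ, hφ, hlim⟩ := (isCompact_sphere (0 : R2) 1).tendsto_subseq
    (x := u) (fun n => by simp [hu])
  have ht : Tendsto (fun n : ℕ => 1 / ((n : ℝ) + 2)) atTop (nhds 0) :=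
    tendsto_const_nhds.div_atTop
      (tendsto_atTop_add_const_right _ _ tendsto_natCast_atTop_atTop)
  have htφ := ht.comp hφ.tendsto_atTop
  refine ⟨v, by simpa using hv, ?_, fun a ha => ?_⟩
  · refine le_of_tendsto_of_tendsto' (f := fun n => 1 / 2 - 1 / ((φ n : ℝ) + 2)) ?_
      (hlim.inner tendsto_const_nhds) (fun n => hue (φ n))
    have := htφ.const_sub (1 / 2)
    rwa [sub_zero] at this
  · refine le_of_tendsto_of_tendsto' (hlim.inner tendsto_const_nhds)
      (g := fun n => 1 + 2 * (1 / ((φ n : ℝ) + 2))) ?_ (fun n => huL (φ n) a ha)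
    simpa using (htφ.const_mul 2).const_add 1

/-- The point of the plane with polar coordinates `(r, θ)`. -/
def polarPoint (r θ : ℝ) : R2 := !₂[r * cos θ, r * sin θ]

lemma inner_polarPoint (r θ s φ : ℝ) :
    inner ℝ (polarPoint r θ) (polarPoint s φ) = r * s * cos (θ - φ) := by
  simp [polarPoint, PiLp.inner_apply, Fin.sum_univ_two, cos_sub]
  ring

lemma norm_polarPoint {r : ℝ} (hr : 0 ≤ r) (θ : ℝ) : ‖polarPoint r θ‖ = r := by
  have h : ‖polarPoint r θ‖ ^ 2 = r ^ 2 := by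
    rw [← real_inner_self_eq_norm_sq, inner_polarPoint]; simp; ring
  exact (sq_eq_sq₀ (norm_nonneg _) hr).1 h

lemma norm_polarPoint_one (θ : ℝ) : ‖polarPoint 1 θ‖ = 1 :=
  norm_polarPoint zero_le_one θ

lemma exists_eq_polarPoint_one {u : R2} (hu : ‖u‖ = 1) : ∃ θ, u = polarPoint 1 θ := by
  have h1 : u 0 ^ 2 + u 1 ^ 2 = 1 := by
    have := EuclideanSpace.real_norm_sq_eq u
    rw [hu, Fin.sum_univ_two] at this
    linarith
  obtain ⟨z, hz0, hz⟩ : ∃ z : ℂ, z.re = u 0 ∧ z.im = u 1 := ⟨⟨u 0, u 1⟩, rfl, rfl⟩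
  have hz1 : ‖z‖ = 1 := by
    have h : ‖z‖ ^ 2 = 1 := by
      rw [← Complex.normSq_eq_norm_sq, Complex.normSq_apply]; rw [hz0, hz]; linarith
    nlinarith [norm_nonneg z]
  refine ⟨z.arg, ?_⟩
  have hc := Complex.norm_mul_cos_arg z
  have hs := Complex.norm_mul_sin_arg z
  rw [hz1, one_mul] at hc hs
  rw [hz0] at hc
  rw [hz] at hs
  ext i
  fin_cases i <;> simp [polarPoint, hc, hs]

lemma continuous_polarPoint : Continuous fun p : ℝ × ℝ => polarPoint p.1 p.2 := by
  refine (PiLp.continuous_toLp 2 _).comp (continuous_pi fun i => ?_)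
  fin_cases i <;> simp <;> fun_prop

/-- The directions of the supporting lines of `L` at distance at most one from the origin. -/
def contactAngles (L : Set R2) : Set ℝ := {θ | ∀ a ∈ L, inner ℝ (polarPoint 1 θ) a ≤ 1}

lemma isClosed_contactAngles (L : Set R2) : IsClosed (contactAngles L) := by
  simp only [contactAngles, Set.ofPred_forall]
  refine isClosed_biInter fun a _ => isClosed_le ?_ continuous_const
  exact (continuous_polarPoint.comp (Continuous.prodMk_right (1 : ℝ))).inner continuous_const

lemma polarPoint_add_int_mul_two_pi (r θ : ℝ) (k : ℤ) :
    polarPoint r (θ + k * (2 * π)) = polarPoint r θ := by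
  simp [polarPoint, cos_add_int_mul_two_pi, sin_add_int_mul_two_pi]

lemma abs_le_pi_div_three_of_half_le_cos {x : ℝ} (hx : |x| ≤ π) (h : 1 / 2 ≤ cos x) :
    |x| ≤ π / 3 := by
  by_contra! hlt
  have h1 := cos_lt_cos_of_nonneg_of_le_pi (by positivity) hx hlt
  rw [cos_abs, cos_pi_div_three] at h1
  linarith

lemma JohnPosition.exists_contactAngle {L : Set R2} (h : JohnPosition L) (φ : ℝ) :
    ∃ θ ∈ contactAngles L, |θ - φ| ≤ π / 3 := by
  obtain ⟨u, hu, hue, huL⟩ := h.exists_contact (norm_polarPoint_one φ)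
  obtain ⟨θ, rfl⟩ := exists_eq_polarPoint_one hu
  rw [inner_polarPoint, one_mul, one_mul] at hue
  have hper : ∃ k : ℤ, |θ - φ + k * (2 * π)| ≤ π := by
    obtain ⟨h1, h2⟩ := toIocMod_mem_Ioc two_pi_pos (-π) (θ - φ)
    refine ⟨-toIocDiv two_pi_pos (-π) (θ - φ), ?_⟩
    have h3 := toIocMod_add_toIocDiv_zsmul two_pi_pos (-π) (θ - φ)
    rw [zsmul_eq_mul] at h3
    push_cast
    rw [abs_le]
    constructor <;> linarith
  obtain ⟨k, hk⟩ := hper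
  refine ⟨θ + k * (2 * π), ?_, ?_⟩
  · intro a ha
    rw [polarPoint_add_int_mul_two_pi]
    exact huL a ha
  · rw [add_sub_right_comm]
    exact abs_le_pi_div_three_of_half_le_cos hk (by rwa [cos_add_int_mul_two_pi])

/-- A function that decreases between points of a closed set at distance at most `2δ` decreases
along the set, if each interval of length `2δ` meets the set. -/
lemma antitoneOn_of_local_of_relatively_dense {T : Set ℝ} (hT : IsClosed T) {δ : ℝ} (hδ : 0 < δ)
    (hd : ∀ x, ∃ y ∈ T, |y - x| ≤ δ) {H : ℝ → ℝ}
    (hH : ∀ p ∈ T, ∀ q ∈ T, p ≤ q → q ≤ p + 2 * δ → H q ≤ H p) : AntitoneOn H T := by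
  have key : ∀ n : ℕ, ∀ p ∈ T, ∀ q ∈ T, p ≤ q → q ≤ p + n * (2 * δ) → H q ≤ H p := by
    intro n
    induction n with
    | zero =>
      intro p hp q hq hpq hle
      exact hH p hp q hq hpq (by push_cast at hle; linarith)
    | succ n ih =>
      intro p hp q hq hpq hle
      rcases le_total q (p + 2 * δ) with hs | hs
      · exact hH p hp q hq hpq hs
      obtain ⟨v, ⟨hvT, hpv, hv⟩, hvmax⟩ := (isCompact_Icc.inter_left hT).exists_isGreatest
        (s := T ∩ Icc p (p + 2 * δ)) ⟨p, hp, le_rfl, by linarith⟩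
      obtain ⟨w, ⟨hwT, hw, hwq⟩, hwmin⟩ := (isCompact_Icc.inter_left hT).exists_isLeast
        (s := T ∩ Icc (p + 2 * δ) q) ⟨q, hq, hs, le_rfl⟩
      have hgap : w ≤ v + 2 * δ := by
        by_contra! hlt
        obtain ⟨y, hyT, hy⟩ := hd ((v + w) / 2)
        obtain ⟨hy1, hy2⟩ := abs_le.1 hy
        rcases le_total y (p + 2 * δ) with h | h
        · have := hvmax ⟨hyT, by linarith, h⟩
          linarith
        · have := hwmin ⟨hyT, h, by linarith⟩
          linarith
      calc H q ≤ H w := ih w hwT q hq hwq (by push_cast at hle; linarith)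
        _ ≤ H v := hH v hvT w hwT (by linarith) hgap
        _ ≤ H p := hH p hp v hvT hpv hv
  intro p hp q hq hpq
  obtain ⟨n, hn⟩ := exists_nat_ge ((q - p) / (2 * δ))
  rw [div_le_iff₀ (by linarith)] at hn
  exact key n p hp q hq hpq (by linarith)

lemma tan_le_mul_of_le_pi_div_three {x : ℝ} (h0 : 0 ≤ x) (h1 : x ≤ π / 3) :
    tan x ≤ 3 * √3 / π * x := by
  have hpi := pi_pos
  have hcos : ∀ y ∈ Icc 0 (π / 3), 0 < cos y := fun y hy =>
    cos_pos_of_mem_Ioo ⟨by linarith [hy.1], by linarith [hy.2]⟩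
  have hconv : ConvexOn ℝ (Icc 0 (π / 3)) tan := by
    refine MonotoneOn.convexOn_of_deriv (convex_Icc _ _)
      (fun y hy => (continuousAt_tan.2 (hcos y hy).ne').continuousWithinAt)
      (fun y hy => (differentiableAt_tan.2
        (hcos y (interior_subset hy)).ne').differentiableWithinAt) ?_
    intro y hy z hz hyz
    have hy' := interior_subset hy
    have hz' := interior_subset hz
    rw [deriv_tan, deriv_tan]
    have := cos_le_cos_of_nonneg_of_le_pi hy'.1 (by linarith [hz'.2]) hyz
    have hz0 := hcos z hz'
    gcongr
  have ht0 : 0 ≤ x / (π / 3) := by positivity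
  have ht1 : x / (π / 3) ≤ 1 := by rwa [div_le_one (by positivity)]
  have h := hconv.2 (x := 0) (y := π / 3) ⟨le_rfl, by positivity⟩ ⟨by positivity, le_rfl⟩
    (sub_nonneg.2 ht1) ht0 (by ring)
  simp only [smul_eq_mul, mul_zero, zero_add, tan_zero, tan_pi_div_three] at h
  rw [div_mul_cancel₀ _ (by positivity)] at h
  calc tan x ≤ x / (π / 3) * √3 := h
    _ = 3 * √3 / π * x := by field_simp

/-- The density of the area of `L` with respect to the polar angle. -/
def angularDensity (L : Set R2) (θ : ℝ) : ℝ :=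
  ∫ r in Ioi (0 : ℝ), r * L.indicator 1 (polarPoint r θ)

lemma angularDensity_periodic (L : Set R2) : Function.Periodic (angularDensity L) (2 * π) := by
  intro θ
  have := fun r => polarPoint_add_int_mul_two_pi r θ 1
  simp only [Int.cast_one, one_mul] at this
  simp only [angularDensity, this]

lemma angularDensity_nonneg (L : Set R2) (θ : ℝ) : 0 ≤ angularDensity L θ :=
  setIntegral_nonneg measurableSet_Ioi fun _ hr =>
    mul_nonneg (le_of_lt hr) (indicator_nonneg (fun _ _ => zero_le_one) _)

lemma angularDensity_le {L : Set R2} {θ R : ℝ} (hR : 0 ≤ R)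
    (h : ∀ r, 0 < r → polarPoint r θ ∈ L → r ≤ R) : angularDensity L θ ≤ R ^ 2 / 2 := by
  have h1 : ∫ r in Ioi (0 : ℝ), (Ioc 0 R).indicator id r = R ^ 2 / 2 := by
    rw [setIntegral_indicator measurableSet_Ioc, inter_eq_self_of_subset_right Ioc_subset_Ioi_self,
      ← intervalIntegral.integral_of_le hR]
    simp
  rw [← h1, angularDensity]
  refine integral_mono_of_nonneg ?_ ?_ ?_
  · exact (ae_restrict_mem measurableSet_Ioi).mono fun _ hr =>
      mul_nonneg (le_of_lt hr) (indicator_nonneg (fun _ _ => zero_le_one) _)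
  · refine Integrable.integrableOn ?_
    rw [integrable_indicator_iff measurableSet_Ioc]
    exact (continuous_id.integrableOn_Icc (a := 0) (b := R)).mono_set Ioc_subset_Icc_self
  · refine (ae_restrict_mem measurableSet_Ioi).mono fun r hr => ?_
    by_cases hrL : polarPoint r θ ∈ L
    · simp [hrL, indicator_of_mem (show r ∈ Ioc 0 R from ⟨hr, h r hr hrL⟩)]
    · simp only [hrL, not_false_eq_true, indicator_of_notMem, mul_zero]
      exact indicator_nonneg (fun x hx => hx.1.le) _

lemma angularDensity_le_of_contact {L : Set R2} {θ p : ℝ} (hp : p ∈ contactAngles L)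
    (hcos : 0 < cos (p - θ)) : angularDensity L θ ≤ (1 / 2) * (1 / cos (p - θ) ^ 2) := by
  have := angularDensity_le (L := L) (θ := θ) (R := 1 / cos (p - θ)) (by positivity)
    fun _ _ hrL => by
      have := hp _ hrL
      rw [inner_polarPoint, one_mul] at this
      rwa [le_div_iff₀ hcos]
  refine this.trans_eq ?_
  ring

lemma stronglyMeasurable_angularDensity {L : Set R2} (hL : MeasurableSet L) :
    StronglyMeasurable (angularDensity L) := by
  have h : Measurable fun q : ℝ × ℝ => q.2 * L.indicator (1 : R2 → ℝ) (polarPoint q.2 q.1) :=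
    measurable_snd.mul ((measurable_one.indicator hL).comp
      (continuous_polarPoint.measurable.comp measurable_swap))
  exact h.stronglyMeasurable.integral_prod_right' (ν := volume.restrict (Ioi 0))

lemma JohnPosition.angularDensity_le_two {L : Set R2} (h : JohnPosition L) (θ : ℝ) :
    angularDensity L θ ≤ 2 := by
  obtain ⟨p, hp, hpθ⟩ := h.exists_contactAngle θ
  have hcos : 1 / 2 ≤ cos (p - θ) := by
    rw [← cos_pi_div_three, ← cos_abs (p - θ)]
    exact cos_le_cos_of_nonneg_of_le_pi (abs_nonneg _) (by linarith [pi_pos]) hpθ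
  refine (angularDensity_le_of_contact hp (by linarith)).trans ?_
  have : 1 / cos (p - θ) ^ 2 ≤ 1 / (1 / 2) ^ 2 := by gcongr
  linarith

lemma JohnPosition.intervalIntegrable_angularDensity {L : Set R2} (h : JohnPosition L) (a b : ℝ) :
    IntervalIntegrable (angularDensity L) volume a b := by
  refine (intervalIntegrable_const (c := (2 : ℝ))).mono_fun
    (stronglyMeasurable_angularDensity h.isCompact.measurableSet).aestronglyMeasurable
    (Eventually.of_forall fun θ => ?_)
  dsimp only
  rw [Real.norm_of_nonneg (angularDensity_nonneg L θ)]
  simpa using h.angularDensity_le_two θ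

lemma integral_inv_cos_sq {a : ℝ} (h0 : 0 ≤ a) (ha : a < π / 2) :
    IntervalIntegrable (fun x => 1 / cos x ^ 2) volume 0 a ∧ ∫ x in 0..a, 1 / cos x ^ 2 = tan a := by
  have hcos : ∀ x ∈ uIcc 0 a, cos x ≠ 0 := fun x hx => by
    rw [uIcc_of_le h0] at hx
    exact (cos_pos_of_mem_Ioo ⟨by linarith [hx.1, pi_pos], by linarith [hx.2]⟩).ne'
  have hi : IntervalIntegrable (fun x => 1 / cos x ^ 2) volume 0 a :=
    ContinuousOn.intervalIntegrable
      (continuousOn_const.div (continuous_cos.pow 2).continuousOn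
        fun x hx => pow_ne_zero 2 (hcos x hx))
  refine ⟨hi, ?_⟩
  rw [intervalIntegral.integral_eq_sub_of_hasDerivAt (fun x hx => hasDerivAt_tan (hcos x hx)) hi]
  simp

/-- A bound for the area of the sector of `L` between two contact angles. -/
lemma JohnPosition.integral_angularDensity_le {L : Set R2} (h : JohnPosition L) {p q : ℝ}
    (hp : p ∈ contactAngles L) (hq : q ∈ contactAngles L) (hpq : p ≤ q)
    (hle : q ≤ p + 2 * (π / 3)) :
    ∫ θ in p..q, angularDensity L θ ≤ 3 * √3 / (2 * π) * (q - p) := by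
  set a : ℝ := (q - p) / 2 with ha
  have ha0 : 0 ≤ a := by linarith
  have ha3 : a ≤ π / 3 := by linarith
  have hpi := pi_pos
  obtain ⟨hi, hint⟩ := integral_inv_cos_sq ha0 (by linarith)
  have hcos : ∀ x ∈ Icc 0 a, 0 < cos x := fun x hx =>
    cos_pos_of_mem_Ioo ⟨by linarith [hx.1], by linarith [hx.2]⟩
  have hleft : ∫ θ in p..p + a, angularDensity L θ ≤ (1 / 2) * tan a := by
    have hsub : ∫ θ in p..p + a, angularDensity L θ = ∫ x in 0..a, angularDensity L (p + x) := by
      rw [intervalIntegral.integral_comp_add_left (fun x => angularDensity L x), add_zero]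
    rw [hsub, ← hint, ← intervalIntegral.integral_const_mul]
    refine intervalIntegral.integral_mono_on ha0 ?_ (hi.const_mul _) fun x hx => ?_
    · simpa using (h.intervalIntegrable_angularDensity p (p + a)).comp_add_left p
    · have hx' : cos (p - (p + x)) = cos x := by rw [← cos_neg]; congr 1; ring
      have := angularDensity_le_of_contact hp (θ := p + x) (by rw [hx']; exact hcos x hx)
      rwa [hx'] at this
  have hright : ∫ θ in p + a..q, angularDensity L θ ≤ (1 / 2) * tan a := by
    have hsub : ∫ θ in p + a..q, angularDensity L θ = ∫ x in 0..a, angularDensity L (q - x) := by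
      rw [intervalIntegral.integral_comp_sub_left (fun x => angularDensity L x), sub_zero]
      congr 1; linarith
    rw [hsub, ← hint, ← intervalIntegral.integral_const_mul]
    refine intervalIntegral.integral_mono_on ha0 ?_ (hi.const_mul _) fun x hx => ?_
    · simpa using (h.intervalIntegrable_angularDensity q (q - a)).comp_sub_left q
    · have hx' : cos (q - (q - x)) = cos x := by congr 1; ring
      have := angularDensity_le_of_contact hq (θ := q - x) (by rw [hx']; exact hcos x hx)
      rwa [hx'] at this
  rw [← intervalIntegral.integral_add_adjacent_intervals (h.intervalIntegrable_angularDensity p (p + a))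
    (h.intervalIntegrable_angularDensity (p + a) q)]
  have htan := tan_le_mul_of_le_pi_div_three ha0 ha3
  have : 3 * √3 / (2 * π) * (q - p) = 3 * √3 / π * a := by rw [ha]; field_simp
  linarith

lemma JohnPosition.integral_two_pi_le {L : Set R2} (h : JohnPosition L) :
    ∫ θ in -π..π, angularDensity L θ ≤ 3 * √3 := by
  obtain ⟨p, hp, -⟩ := h.exists_contactAngle 0
  have hp2 : p + 2 * π ∈ contactAngles L := fun a ha => by
    have := polarPoint_add_int_mul_two_pi 1 p 1
    simp only [Int.cast_one, one_mul] at this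
    rw [this]
    exact hp a ha
  have hanti : AntitoneOn
      (fun x => (∫ θ in 0..x, angularDensity L θ) - 3 * √3 / (2 * π) * x) (contactAngles L) := by
    refine antitoneOn_of_local_of_relatively_dense (isClosed_contactAngles L)
      (δ := π / 3) (by positivity) h.exists_contactAngle fun a ha b hb hab hle => ?_
    have h1 := h.integral_angularDensity_le ha hb hab hle
    have h2 := intervalIntegral.integral_add_adjacent_intervals (h.intervalIntegrable_angularDensity 0 a)
      (h.intervalIntegrable_angularDensity a b)
    linarith
  have h1 := hanti hp hp2 (by linarith [pi_pos])
  rw [sub_le_sub_iff] at h1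
  have h2 := intervalIntegral.integral_add_adjacent_intervals (h.intervalIntegrable_angularDensity 0 p)
      (h.intervalIntegrable_angularDensity p (p + 2 * π))
  have h3 := (angularDensity_periodic L).intervalIntegral_add_eq p (-π)
  have h4 : 3 * √3 / (2 * π) * (p + 2 * π) = 3 * √3 / (2 * π) * p + 3 * √3 := by
    field_simp
  rw [show -π + 2 * π = π by ring] at h3
  linarith

lemma volume_eq_integral_angularDensity {L : Set R2} (hL : IsCompact L) :
    volume.real L = ∫ θ in -π..π, angularDensity L θ := by
  have hpi := pi_pos
  obtain ⟨R, hR⟩ := hL.isBounded.exists_norm_le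
  have hmeas : Measurable fun q : ℝ × ℝ => q.1 * L.indicator (1 : R2 → ℝ) (polarPoint q.1 q.2) :=
    measurable_fst.mul ((measurable_one.indicator hL.measurableSet).comp
      continuous_polarPoint.measurable)
  have hint : IntegrableOn
      (fun q : ℝ × ℝ => q.1 * L.indicator (1 : R2 → ℝ) (polarPoint q.1 q.2))
      (Ioi 0 ×ˢ Ioo (-π) π) (volume.prod volume) := by
    have hdom : IntegrableOn ((Ioc 0 R ×ˢ univ).indicator fun _ : ℝ × ℝ => R)
        (Ioi 0 ×ˢ Ioo (-π) π) (volume.prod volume) := by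
      rw [IntegrableOn, integrable_indicator_iff (measurableSet_Ioc.prod MeasurableSet.univ),
        IntegrableOn, Measure.restrict_restrict (measurableSet_Ioc.prod MeasurableSet.univ),
        prod_inter_prod]
      refine integrableOn_const ?_
      rw [Measure.prod_prod]
      refine ENNReal.mul_ne_top (measure_ne_top_of_subset inter_subset_left ?_)
        (measure_ne_top_of_subset inter_subset_right ?_) <;> simp
    refine hdom.mono' hmeas.aestronglyMeasurable ?_
    refine (ae_restrict_mem (measurableSet_Ioi.prod measurableSet_Ioo)).mono fun q hq => ?_
    have hq0 : 0 < q.1 := hq.1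
    by_cases hqL : polarPoint q.1 q.2 ∈ L
    · have hqR : q.1 ≤ R := by simpa [norm_polarPoint hq0.le] using hR _ hqL
      rw [indicator_of_mem (show q ∈ Ioc 0 R ×ˢ univ from ⟨⟨hq0, hqR⟩, trivial⟩)]
      simpa [hqL, abs_of_pos hq0] using hqR
    · simp only [hqL, not_false_eq_true, indicator_of_notMem, mul_zero, norm_zero]
      exact indicator_nonneg (fun x hx => hx.1.1.le.trans hx.1.2) _
  have hΦ := Complex.orthonormalBasisOneI.repr.measurePreserving
  have hemb := Complex.orthonormalBasisOneI.repr.toMeasurableEquiv.measurableEmbedding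
  have hpt : ∀ q : ℝ × ℝ,
      Complex.orthonormalBasisOneI.repr (Complex.polarCoord.symm q) = polarPoint q.1 q.2 := by
    intro q
    ext i
    fin_cases i <;>
      simp [polarPoint, Complex.orthonormalBasisOneI_repr_apply, Complex.polarCoord_symm_apply,
        -Complex.ofReal_cos, -Complex.ofReal_sin]
  rw [← integral_indicator_one hL.measurableSet, ← hΦ.integral_comp hemb,
    ← Complex.integral_comp_polarCoord_symm, polarCoord_target]
  simp only [hpt, smul_eq_mul]
  rw [Measure.volume_eq_prod, ← setIntegral_prod_swap]
  refine (setIntegral_prod _ hint.swap).trans ?_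
  rw [intervalIntegral.integral_of_le (by linarith), integral_Ioc_eq_integral_Ioo]
  rfl

lemma JohnPosition.volume_le {L : Set R2} (h : JohnPosition L) : volume.real L ≤ 3 * √3 := by
  rw [volume_eq_integral_angularDensity h.isCompact]
  exact h.integral_two_pi_le

lemma exists_maximal_ellipse {K : Set R2} (hKc : IsCompact K) (hKint : (interior K).Nonempty) :
    ∃ (A : R2 →L[ℝ] R2) (c : R2), A.det ≠ 0 ∧ (∀ x ∈ Metric.closedBall (0 : R2) 1, A x + c ∈ K) ∧
      ∀ (B : R2 →L[ℝ] R2) (d : R2), (∀ x ∈ Metric.closedBall (0 : R2) 1, B x + d ∈ K) →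
        |B.det| ≤ |A.det| := by
  set S : Set ((R2 →L[ℝ] R2) × R2) :=
    {P | ∀ x ∈ Metric.closedBall (0 : R2) 1, P.1 x + P.2 ∈ K} with hS
  have hclosed : IsClosed S := by
    simp only [hS, Set.ofPred_forall]
    exact isClosed_biInter fun x _ => hKc.isClosed.preimage (by fun_prop)
  obtain ⟨R, hR⟩ := hKc.isBounded.exists_norm_le
  have hbdd : S ⊆ Metric.closedBall 0 (2 * R) := by
    rintro ⟨A, c⟩ hP
    have hc : ‖c‖ ≤ R := hR c (by simpa using hP 0 (by simp))
    have hR0 : 0 ≤ R := (norm_nonneg c).trans hc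
    have hA : ‖A‖ ≤ 2 * R := by
      refine A.opNorm_le_of_unit_norm (by positivity) fun x hx => ?_
      have h1 := hR _ (hP x (by simp [hx]))
      calc ‖A x‖ = ‖(A x + c) - c‖ := by rw [add_sub_cancel_right]
        _ ≤ ‖A x + c‖ + ‖c‖ := norm_sub_le _ _
        _ ≤ 2 * R := by linarith
    rw [mem_closedBall_zero_iff, Prod.norm_def]
    exact max_le hA (by linarith)
  have hcomp : IsCompact S := (isCompact_closedBall _ _).of_isClosed_subset hclosed hbdd
  obtain ⟨c₀, hc₀⟩ := hKint
  obtain ⟨ε, hε, hball⟩ := Metric.nhds_basis_closedBall.mem_iff.1 (mem_interior_iff_mem_nhds.1 hc₀)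
  have hmem : (ε • ContinuousLinearMap.id ℝ R2, c₀) ∈ S := by
    intro x hx
    apply hball
    have : ‖x‖ ≤ 1 := by simpa using hx
    simpa [norm_smul, abs_of_pos hε] using mul_le_of_le_one_right hε.le this
  obtain ⟨⟨A, c⟩, hAS, hmax⟩ := hcomp.exists_isMaxOn ⟨_, hmem⟩
    (f := fun P : (R2 →L[ℝ] R2) × R2 => |P.1.det|)
    (ContinuousLinearMap.continuous_det.comp continuous_fst).abs.continuousOn
  refine ⟨A, c, ?_, hAS, fun B d hB => hmax (show (B, d) ∈ S from hB)⟩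
  have h1 : |(ε • ContinuousLinearMap.id ℝ R2).det| ≤ |A.det| := hmax hmem
  have h2 : (ε • ContinuousLinearMap.id ℝ R2).det = ε ^ 2 := by
    simp [ContinuousLinearMap.det]
  rw [h2] at h1
  exact abs_pos.1 ((abs_pos.2 (by positivity)).trans_le h1)

lemma volume_affineEquiv_image (f : R2 ≃ᵃ[ℝ] R2) (s : Set R2) :
    volume (f '' s) = ENNReal.ofReal |LinearMap.det (f.linear : R2 →ₗ[ℝ] R2)| * volume s := by
  have h : ⇑f = (fun x => x + f 0) ∘ (f.linear : R2 →ₗ[ℝ] R2) := by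
    ext1 x
    have := f.map_vadd 0 x
    simpa using this
  rw [h, image_comp, image_add_right, measure_preimage_add_right,
    Measure.addHaar_image_linearMap]

/-- Every convex body in the plane contains an ellipse (an invertible affine image of the
closed unit disk) of area at least `(π/(3√3))·A(K)`. -/
theorem statement14 (K : Set R2) (hKc : IsCompact K) (hKconv : Convex ℝ K)
    (hKint : (interior K).Nonempty) :
    ∃ f : R2 ≃ᵃ[ℝ] R2, ⇑f '' Metric.closedBall (0 : R2) 1 ⊆ K ∧
      π / (3 * Real.sqrt 3) * (volume K).toReal ≤
        (volume (⇑f '' Metric.closedBall (0 : R2) 1)).toReal := by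
  obtain ⟨A, c, hdet, hAK, hmax⟩ := exists_maximal_ellipse hKc hKint
  set f : R2 ≃ᵃ[ℝ] R2 := ((A : R2 →ₗ[ℝ] R2).equivOfDetNeZero hdet).toAffineEquiv.trans
    (AffineEquiv.constVAdd ℝ R2 c) with hf
  have hfx : ∀ x, f x = A x + c := fun x => by
    simp [hf, add_comm, LinearMap.equivOfDetNeZero]
  have hlin : (f.linear : R2 →ₗ[ℝ] R2) = A := by
    rfl
  have hfK : f '' (f ⁻¹' K) = K := image_preimage_eq K f.surjective
  have hcont : Continuous f.symm := f.symm.continuous_of_finiteDimensional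
  have hJ : JohnPosition (f ⁻¹' K) :=
    { isCompact := by
        have : f ⁻¹' K = f.symm '' K := (f.toEquiv.image_symm_eq_preimage K).symm
        rw [this]
        exact hKc.image hcont
      convex := hKconv.affine_preimage f.toAffineMap
      closedBall_subset := fun x hx => by
        rw [mem_preimage, hfx]
        exact hAK x hx
      abs_det_le := fun B d hB => by
        have h1 := hmax (A.comp B) (A d + c) fun x hx => by
          have := hB x hx
          rw [mem_preimage, hfx, map_add, add_assoc] at this
          exact this
        have h2 : (A.comp B).det = A.det * B.det := LinearMap.det_comp _ _
        rw [h2, abs_mul] at h1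
        exact le_of_mul_le_mul_left (by simpa using h1) (abs_pos.2 hdet) }
  refine ⟨f, ?_, ?_⟩
  · rintro _ ⟨x, hx, rfl⟩
    rw [hfx]
    exact hAK x hx
  · have hball : (volume (Metric.closedBall (0 : R2) 1)).toReal = π := by
      simp [InnerProductSpace.volume_closedBall_of_dim_even (k := 1) (E := R2) (by simp), pi_nonneg]
    have hvol := hJ.volume_le
    conv_lhs => rw [← hfK]
    rw [volume_affineEquiv_image, volume_affineEquiv_image, ENNReal.toReal_mul,
      ENNReal.toReal_mul, hball, ENNReal.toReal_ofReal (abs_nonneg _)]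
    rw [Measure.real] at hvol
    have hs : 0 < 3 * √3 := by positivity
    calc π / (3 * √3) * (|LinearMap.det (f.linear : R2 →ₗ[ℝ] R2)| * (volume (f ⁻¹' K)).toReal)
        ≤ π / (3 * √3) * (|LinearMap.det (f.linear : R2 →ₗ[ℝ] R2)| * (3 * √3)) := by gcongr
      _ = |LinearMap.det (f.linear : R2 →ₗ[ℝ] R2)| * π := by field_simp
end
end

section
/- Let α ∈ (0,1] and γ > 0, and let v_{α,γ}(x,y) = 2 log((1+γ²)/(1+γ²(α²x²+y²))). Then for every (x,y) ∈ ℝ² one has −Δ v_{α,γ}(x,y) = (4γ²/(1+γ²)²)(1 + α² + γ²(1−α²)(α²x² − y²)) · e^{v_{α,γ}(x,y)}; moreover v_{α,γ} = 0 on ∂ω_α, and for every (x,y) ∈ ω_α the coefficient satisfies (4γ²/(1+γ²)²)(1 + α² + γ²(1−α²)(α²x² − y²)) ≥ (4γ²/(1+γ²)²)(1 + α² + γ²(α² − 1)). In particular, v_{α,γ} is a (classical) supersolution of −Δu = μ e^u on ω_α whenever 0 < μ ≤ (4γ²/(1+γ²)²)(1 + α² + γ²(α² − 1)). -/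
open MeasureTheory Real Set Filter

noncomputable section

/-- `v_{α,γ}(x,y) = 2 log((1+γ²)/(1+γ²(α²x²+y²)))`. -/
def vag (α γ : ℝ) (p : R2) : ℝ :=
  2 * Real.log ((1 + γ ^ 2) / (1 + γ ^ 2 * (α ^ 2 * p 0 ^ 2 + p 1 ^ 2)))

/-- The second derivative at `0` of `t ↦ 2 log (c / (a + b (s + t)²))`. -/
theorem iteratedDeriv_two_log_div_quadratic {a b c : ℝ} (s : ℝ) (ha : 0 < a) (hb : 0 ≤ b)
    (hc : 0 < c) :
    iteratedDeriv 2 (fun t : ℝ => 2 * Real.log (c / (a + b * (s + t) ^ 2))) 0 =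
      -(4 * b * (a + b * s ^ 2) - 8 * b ^ 2 * s ^ 2) / (a + b * s ^ 2) ^ 2 := by
  have hpos (t : ℝ) : 0 < a + b * (s + t) ^ 2 := by positivity
  have hquad (t : ℝ) : HasDerivAt (fun t : ℝ => a + b * (s + t) ^ 2) (2 * b * (s + t)) t := by
    have h := ((((hasDerivAt_id t).const_add s).pow 2).const_mul b).const_add a
    refine h.congr_deriv ?_
    simp
    ring
  have hfirst : deriv (fun t : ℝ => 2 * Real.log (c / (a + b * (s + t) ^ 2))) =
      fun t => -(4 * b * (s + t)) / (a + b * (s + t) ^ 2) := by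
    funext t
    have hsplit : (fun t : ℝ => 2 * Real.log (c / (a + b * (s + t) ^ 2))) =
        fun t => 2 * (Real.log c - Real.log (a + b * (s + t) ^ 2)) := by
      funext t
      rw [Real.log_div hc.ne' (hpos t).ne']
    rw [hsplit, ((((hquad t).log (hpos t).ne').const_sub (Real.log c)).const_mul 2).deriv]
    ring
  have hnum : HasDerivAt (fun t : ℝ => -(4 * b * (s + t))) (-(4 * b)) 0 := by
    simpa using (((hasDerivAt_id (0 : ℝ)).const_add s).const_mul (4 * b)).fun_neg
  rw [iteratedDeriv_succ, iteratedDeriv_one, hfirst,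
    (hnum.fun_div (hquad 0) (hpos 0).ne').deriv, add_zero]
  ring

theorem exp_vag (α γ : ℝ) (p : R2) :
    Real.exp (vag α γ p) =
      (1 + γ ^ 2) ^ 2 / (1 + γ ^ 2 * (α ^ 2 * p 0 ^ 2 + p 1 ^ 2)) ^ 2 := by
  have hpos : 0 < (1 + γ ^ 2) / (1 + γ ^ 2 * (α ^ 2 * p 0 ^ 2 + p 1 ^ 2)) := by positivity
  rw [vag, two_mul, Real.exp_add, Real.exp_log hpos, ← sq, div_pow]

theorem neg_lap_vag (α γ : ℝ) (p : R2) :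
    -lap (vag α γ) p =
      4 * γ ^ 2 / (1 + γ ^ 2) ^ 2 *
        (1 + α ^ 2 + γ ^ 2 * (1 - α ^ 2) * (α ^ 2 * p 0 ^ 2 - p 1 ^ 2)) *
        Real.exp (vag α γ p) := by
  have hx : (fun t : ℝ => vag α γ (p + t • EuclideanSpace.single 0 (1 : ℝ))) =
      fun t => 2 * Real.log ((1 + γ ^ 2) /
        ((1 + γ ^ 2 * p 1 ^ 2) + γ ^ 2 * α ^ 2 * (p 0 + t) ^ 2)) := by
    funext t
    simp only [vag, PiLp.add_apply, PiLp.smul_apply, PiLp.single_apply]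
    simp
    ring_nf
  have hy : (fun t : ℝ => vag α γ (p + t • EuclideanSpace.single 1 (1 : ℝ))) =
      fun t => 2 * Real.log ((1 + γ ^ 2) /
        ((1 + γ ^ 2 * α ^ 2 * p 0 ^ 2) + γ ^ 2 * (p 1 + t) ^ 2)) := by
    funext t
    simp only [vag, PiLp.add_apply, PiLp.smul_apply, PiLp.single_apply]
    simp
    ring_nf
  rw [lap, Fin.sum_univ_two, hx, hy, exp_vag,
    iteratedDeriv_two_log_div_quadratic _ (by positivity) (by positivity) (by positivity),
    iteratedDeriv_two_log_div_quadratic _ (by positivity) (by positivity) (by positivity),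
    show 1 + γ ^ 2 * p 1 ^ 2 + γ ^ 2 * α ^ 2 * p 0 ^ 2 =
      1 + γ ^ 2 * (α ^ 2 * p 0 ^ 2 + p 1 ^ 2) by ring,
    show 1 + γ ^ 2 * α ^ 2 * p 0 ^ 2 + γ ^ 2 * p 1 ^ 2 =
      1 + γ ^ 2 * (α ^ 2 * p 0 ^ 2 + p 1 ^ 2) by ring]
  have hD : 1 + γ ^ 2 * (α ^ 2 * p 0 ^ 2 + p 1 ^ 2) ≠ 0 := by positivity
  have hc : 1 + γ ^ 2 ≠ 0 := by positivity
  field_simp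
  ring

theorem vag_eq_zero_of_mem_frontier {α γ : ℝ} {p : R2} (hp : p ∈ frontier (ellipseO α)) :
    vag α γ p = 0 := by
  have hboundary : α ^ 2 * p 0 ^ 2 + p 1 ^ 2 = 1 :=
    frontier_lt_subset_eq (f := fun q : R2 => α ^ 2 * q 0 ^ 2 + q 1 ^ 2) (g := fun _ => 1)
      (by fun_prop) continuous_const hp
  have hc : 1 + γ ^ 2 ≠ 0 := by positivity
  rw [vag, hboundary, mul_one, div_self hc, Real.log_one, mul_zero]

theorem coefficient_lower_bound {α : ℝ} (γ : ℝ) (hα : α ∈ Set.Ioc (0 : ℝ) 1) {p : R2}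
    (hp : p ∈ ellipseO α) :
    4 * γ ^ 2 / (1 + γ ^ 2) ^ 2 * (1 + α ^ 2 + γ ^ 2 * (α ^ 2 - 1)) ≤
      4 * γ ^ 2 / (1 + γ ^ 2) ^ 2 *
        (1 + α ^ 2 + γ ^ 2 * (1 - α ^ 2) * (α ^ 2 * p 0 ^ 2 - p 1 ^ 2)) := by
  have hp' : α ^ 2 * p 0 ^ 2 + p 1 ^ 2 < 1 := hp
  have hα' : 0 ≤ 1 - α ^ 2 := sub_nonneg.2 (pow_le_one₀ hα.1.le hα.2)
  have hlow : 0 ≤ 1 + (α ^ 2 * p 0 ^ 2 - p 1 ^ 2) := by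
    have : 0 ≤ α ^ 2 * p 0 ^ 2 := by positivity
    linarith
  have hprod := mul_nonneg (mul_nonneg (sq_nonneg γ) hα') hlow
  refine mul_le_mul_of_nonneg_left ?_ (by positivity)
  linarith

/-- The Liouville bubble `v_{α,γ}` satisfies `−Δv = V e^v` with explicit coefficient `V`,
vanishes on `∂ω_α`, and the coefficient is bounded below on `ω_α`; hence `v_{α,γ}` is a
classical supersolution of `−Δu = μ eᵘ` whenever `0 < μ ≤ g₊(γ,α)`. -/
theorem statement15 (α γ : ℝ) (hα : α ∈ Set.Ioc (0 : ℝ) 1) (hγ : 0 < γ) :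
    (∀ p : R2, -lap (vag α γ) p =
        4 * γ ^ 2 / (1 + γ ^ 2) ^ 2 *
          (1 + α ^ 2 + γ ^ 2 * (1 - α ^ 2) * (α ^ 2 * p 0 ^ 2 - p 1 ^ 2)) *
          Real.exp (vag α γ p)) ∧
    (∀ p ∈ frontier (ellipseO α), vag α γ p = 0) ∧
    (∀ p ∈ ellipseO α,
      4 * γ ^ 2 / (1 + γ ^ 2) ^ 2 * (1 + α ^ 2 + γ ^ 2 * (α ^ 2 - 1)) ≤
        4 * γ ^ 2 / (1 + γ ^ 2) ^ 2 *
          (1 + α ^ 2 + γ ^ 2 * (1 - α ^ 2) * (α ^ 2 * p 0 ^ 2 - p 1 ^ 2))) ∧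
    (∀ μ : ℝ, 0 < μ →
      μ ≤ 4 * γ ^ 2 / (1 + γ ^ 2) ^ 2 * (1 + α ^ 2 + γ ^ 2 * (α ^ 2 - 1)) →
      ∀ p ∈ ellipseO α, μ * Real.exp (vag α γ p) ≤ -lap (vag α γ) p) := by
  refine ⟨neg_lap_vag α γ, fun p hp => vag_eq_zero_of_mem_frontier hp,
    fun p hp => coefficient_lower_bound γ hα hp, fun μ _ hμ p hp => ?_⟩
  rw [neg_lap_vag]
  exact mul_le_mul_of_nonneg_right (hμ.trans (coefficient_lower_bound γ hα hp))
    (Real.exp_pos _).le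
end
end
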